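/- arXiv:2502.00189 — 10 statements merged into one kernel-verified Lean document; each statement's English description precedes it below -/
import Mathlib

section
/- Let S1 and S2 be Polish spaces, let C = {(B_α^{S1}, B_α^{S2}) : α ∈ A} be a compatibility structure on (S1, S2), let ν be a Borel probability measure on S2 and let Γ be a set of Borel probability measures on S1 × S2. Then the following are equivalent. (a) S_{Γ,C,ν} is nonempty and pointwise uniqueness holds. (b) There exists a strong solution for (Γ,C,ν) and joint uniqueness in law holds. (c) S_{Γ,C,ν} is nonempty, joint uniqueness in law holds, and there exists a Borel measurable map F : S2 → S1 such that for every probability space (Ω,F,P) and every random variable η : Ω → S2 with law(η) = ν, the pair (F(η), η) is a strong solution for (Γ,C,ν); moreover, every weak solution (ξ,η) for (Γ,C,ν) satisfies ξ = F(η) a.s. -/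
open MeasureTheory

namespace YWE

/-!
We formalize Kurtz' version of the Yamada–Watanabe–Engelbert theorem (Theorem 1.3 in the paper).
A compatibility structure on Polish spaces `S1`, `S2` is a family (indexed by `A`) of
sub-σ-algebras `B1 α`, `B2 α` of the respective Borel σ-algebras.  Note that (as explained in
the paper) augmenting the conditioning σ-algebras with the `P`-null sets does not change
conditional expectations up to a.e. equality, so compatibility is stated with the σ-algebras
generated by `ξ` resp. `η` (without null sets), which is an equivalent formulation.
-/

variable {S1 S2 A : Type}

/-- `ξ` is `𝒞`-compatible with `η` for the compatibility structure `𝒞 = {(B1 α, B2 α) : α ∈ A}`: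
for every bounded Borel `h : S2 → ℝ` and every `α`,
`E[h (η) | σ(ξ; B1 α) ∨ σ(η; B2 α)] = E[h (η) | σ(η; B2 α)]` a.s. -/
def Compatible [MeasurableSpace S1] [MeasurableSpace S2] {Ω : Type}
    (B1 : A → MeasurableSpace S1) (B2 : A → MeasurableSpace S2)
    (mΩ : MeasurableSpace Ω) (P : @Measure Ω mΩ) (ξ : Ω → S1) (η : Ω → S2) : Prop :=
  ∀ h : S2 → ℝ, Measurable h → (∃ C : ℝ, ∀ x, |h x| ≤ C) → ∀ α : A,
    P[(fun ω => h (η ω)) | (B1 α).comap ξ ⊔ (B2 α).comap η]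
      =ᵐ[P] P[(fun ω => h (η ω)) | (B2 α).comap η]

/-- The measure `μ` on `S1 × S2` arises as the joint law of a `𝒞`-compatible pair of random
variables on some probability space. -/
def IsCompatiblyRealized [MeasurableSpace S1] [MeasurableSpace S2]
    (B1 : A → MeasurableSpace S1) (B2 : A → MeasurableSpace S2)
    (μ : Measure (S1 × S2)) : Prop :=
  ∃ (Ω : Type) (mΩ : MeasurableSpace Ω) (P : @Measure Ω mΩ)
    (ξ : Ω → S1) (η : Ω → S2),
      IsProbabilityMeasure P ∧ (@Measurable Ω S1 mΩ _ ξ) ∧ (@Measurable Ω S2 mΩ _ η) ∧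
      Compatible B1 B2 mΩ P ξ η ∧ P.map (fun ω => (ξ ω, η ω)) = μ

/-- The set `S_{Γ,𝒞,ν}` of solution laws: members of `Γ` with second marginal `ν` arising as the
joint law of a compatible pair. -/
def SolSet [MeasurableSpace S1] [MeasurableSpace S2]
    (B1 : A → MeasurableSpace S1) (B2 : A → MeasurableSpace S2)
    (Γ : Set (Measure (S1 × S2))) (ν : Measure S2) : Set (Measure (S1 × S2)) :=
  {μ | μ.map Prod.snd = ν ∧ μ ∈ Γ ∧ IsCompatiblyRealized B1 B2 μ}

/-- `(ξ, η)` is a weak solution for `(Γ, 𝒞, ν)`: its joint law belongs to `S_{Γ,𝒞,ν}`. -/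
def IsWeakSolution [MeasurableSpace S1] [MeasurableSpace S2]
    (B1 : A → MeasurableSpace S1) (B2 : A → MeasurableSpace S2)
    (Γ : Set (Measure (S1 × S2))) (ν : Measure S2)
    {Ω : Type} (mΩ : MeasurableSpace Ω) (P : @Measure Ω mΩ)
    (ξ : Ω → S1) (η : Ω → S2) : Prop :=
  IsProbabilityMeasure P ∧ (@Measurable Ω S1 mΩ _ ξ) ∧ (@Measurable Ω S2 mΩ _ η) ∧
    P.map (fun ω => (ξ ω, η ω)) ∈ SolSet B1 B2 Γ ν

/-- `(ξ, η)` is a strong solution for `(Γ, 𝒞, ν)`: a weak solution with `ξ = F (η)` a.s. for a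
Borel measurable `F : S2 → S1`. -/
def IsStrongSolution [MeasurableSpace S1] [MeasurableSpace S2]
    (B1 : A → MeasurableSpace S1) (B2 : A → MeasurableSpace S2)
    (Γ : Set (Measure (S1 × S2))) (ν : Measure S2)
    {Ω : Type} (mΩ : MeasurableSpace Ω) (P : @Measure Ω mΩ)
    (ξ : Ω → S1) (η : Ω → S2) : Prop :=
  IsWeakSolution B1 B2 Γ ν mΩ P ξ η ∧
    ∃ F : S2 → S1, Measurable F ∧ ξ =ᵐ[P] fun ω => F (η ω)

/-- Pointwise uniqueness: two weak solutions on the same probability space driven by the same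
`η` coincide a.s. -/
def PointwiseUniqueness [MeasurableSpace S1] [MeasurableSpace S2]
    (B1 : A → MeasurableSpace S1) (B2 : A → MeasurableSpace S2)
    (Γ : Set (Measure (S1 × S2))) (ν : Measure S2) : Prop :=
  ∀ (Ω : Type) (mΩ : MeasurableSpace Ω) (P : @Measure Ω mΩ)
    (ξ ξ' : Ω → S1) (η : Ω → S2),
    IsWeakSolution B1 B2 Γ ν mΩ P ξ η → IsWeakSolution B1 B2 Γ ν mΩ P ξ' η →
    ξ =ᵐ[P] ξ'

open ProbabilityTheory Measure

section Kernel

variable {X Y : Type*} [MeasurableSpace X] [MeasurableSpace Y]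

/-- A Markov kernel whose values are a.e. concentrated at a point is a.e. given by a measurable
map. -/
lemma exists_measurable_of_ae_eq [StandardBorelSpace X] [Nonempty X] (ν : Measure Y)
    (κ : Kernel Y X) [IsMarkovKernel κ] (h : ∀ᵐ y ∂ν, ∀ᵐ x ∂κ y, ∀ᵐ x' ∂κ y, x = x') :
    ∃ F : Y → X, Measurable F ∧ ∀ᵐ y ∂ν, ∀ᵐ x ∂κ y, x = F y := by
  have he : MeasurableEmbedding (embeddingReal X) := measurableEmbedding_embeddingReal X
  obtain ⟨g, hg, hge⟩ := he.exists_measurable_extend measurable_id fun _ => ‹Nonempty X›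
  refine ⟨fun y => g (∫ x, embeddingReal X x ∂κ y),
    hg.comp he.measurable.stronglyMeasurable.integral_kernel.measurable, ?_⟩
  filter_upwards [h] with y hy
  filter_upwards [hy] with x hx
  have hint : ∫ x', embeddingReal X x' ∂κ y = embeddingReal X x := by
    rw [integral_congr_ae (g := fun _ => embeddingReal X x) (hx.mono fun x' h => by simp [h])]
    simp
  rw [hint]
  exact (congrFun hge x).symm

lemma exists_kernel_map_swap_eq [StandardBorelSpace X] (μ : Measure (X × Y))
    [IsProbabilityMeasure μ] :
    ∃ κ : Kernel Y X, IsMarkovKernel κ ∧ (μ.map Prod.snd ⊗ₘ κ).map Prod.swap = μ := by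
  have : Nonempty X := (nonempty_of_isProbabilityMeasure μ).map Prod.fst
  have : IsProbabilityMeasure (μ.map Prod.swap) :=
    isProbabilityMeasure_map measurable_swap.aemeasurable
  refine ⟨(μ.map Prod.swap).condKernel, inferInstance, ?_⟩
  have hfst : μ.map Prod.snd = (μ.map Prod.swap).fst := by
    rw [fst_map_swap, snd]
  rw [hfst, disintegrate, map_map measurable_swap measurable_swap, Prod.swap_swap_eq, map_id]

lemma map_compProd_prod_left (ν : Measure Y) [IsProbabilityMeasure ν] (κ₁ κ₂ : Kernel Y X)
    [IsMarkovKernel κ₁] [IsMarkovKernel κ₂] :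
    (ν ⊗ₘ (κ₁ ×ₖ κ₂)).map (fun p => (p.2.1, p.1)) = (ν ⊗ₘ κ₁).map Prod.swap := by
  conv_rhs => rw [← Kernel.fst_prod κ₁ κ₂, Kernel.fst_eq, compProd_map measurable_fst,
    map_map measurable_swap (by fun_prop)]
  rfl

lemma map_compProd_prod_right (ν : Measure Y) [IsProbabilityMeasure ν] (κ₁ κ₂ : Kernel Y X)
    [IsMarkovKernel κ₁] [IsMarkovKernel κ₂] :
    (ν ⊗ₘ (κ₁ ×ₖ κ₂)).map (fun p => (p.2.2, p.1)) = (ν ⊗ₘ κ₂).map Prod.swap := by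
  conv_rhs => rw [← Kernel.snd_prod κ₁ κ₂, Kernel.snd_eq, compProd_map measurable_snd,
    map_map measurable_swap (by fun_prop)]
  rfl

end Kernel

section Solutions

variable [MeasurableSpace S1] [MeasurableSpace S2]
  {B1 : A → MeasurableSpace S1} {B2 : A → MeasurableSpace S2}
  {Γ : Set (Measure (S1 × S2))} {ν : Measure S2} {μ : Measure (S1 × S2)}

lemma measurableSet_eq_comp_snd [StandardBorelSpace S1] {F : S2 → S1} (hF : Measurable F) :
    MeasurableSet {p : S1 × S2 | p.1 = F p.2} :=
  measurableSet_eq_fun measurable_fst (hF.comp measurable_snd)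

lemma isProbabilityMeasure_of_mem_solSet (hμ : μ ∈ SolSet B1 B2 Γ ν) :
    IsProbabilityMeasure μ := by
  obtain ⟨-, -, Ω, mΩ, P, ξ, η, hP, hξ, hη, -, rfl⟩ := hμ
  exact isProbabilityMeasure_map (hξ.prodMk hη).aemeasurable

lemma exists_kernel_of_mem_solSet [StandardBorelSpace S1] (hμ : μ ∈ SolSet B1 B2 Γ ν) :
    ∃ κ : Kernel S2 S1, IsMarkovKernel κ ∧ (ν ⊗ₘ κ).map Prod.swap = μ := by
  have := isProbabilityMeasure_of_mem_solSet hμ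
  obtain ⟨κ, hκ, h⟩ := exists_kernel_map_swap_eq μ
  rw [hμ.1] at h
  exact ⟨κ, hκ, h⟩

lemma PointwiseUniqueness.ae_eq_compProd_prod [IsProbabilityMeasure ν]
    (hpu : PointwiseUniqueness B1 B2 Γ ν) (κ₁ κ₂ : Kernel S2 S1)
    [IsMarkovKernel κ₁] [IsMarkovKernel κ₂]
    (h₁ : (ν ⊗ₘ κ₁).map Prod.swap ∈ SolSet B1 B2 Γ ν)
    (h₂ : (ν ⊗ₘ κ₂).map Prod.swap ∈ SolSet B1 B2 Γ ν) :
    ∀ᵐ p ∂(ν ⊗ₘ (κ₁ ×ₖ κ₂)), p.2.1 = p.2.2 := by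
  refine hpu (S2 × S1 × S1) inferInstance (ν ⊗ₘ (κ₁ ×ₖ κ₂)) (fun p => p.2.1) (fun p => p.2.2)
    Prod.fst ⟨inferInstance, by fun_prop, by fun_prop, ?_⟩
    ⟨inferInstance, by fun_prop, by fun_prop, ?_⟩
  · rwa [map_compProd_prod_left]
  · rwa [map_compProd_prod_right]

lemma PointwiseUniqueness.subsingleton_solSet [StandardBorelSpace S1] [IsProbabilityMeasure ν]
    (hpu : PointwiseUniqueness B1 B2 Γ ν) : (SolSet B1 B2 Γ ν).Subsingleton := by
  intro μ₁ h₁ μ₂ h₂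
  obtain ⟨κ₁, hκ₁, rfl⟩ := exists_kernel_of_mem_solSet h₁
  obtain ⟨κ₂, hκ₂, rfl⟩ := exists_kernel_of_mem_solSet h₂
  rw [← map_compProd_prod_left ν κ₁ κ₂, ← map_compProd_prod_right ν κ₁ κ₂]
  refine map_congr ?_
  filter_upwards [hpu.ae_eq_compProd_prod κ₁ κ₂ h₁ h₂] with p hp
  rw [hp]

lemma PointwiseUniqueness.exists_measurable_ae_eq [StandardBorelSpace S1]
    [IsProbabilityMeasure ν] (hpu : PointwiseUniqueness B1 B2 Γ ν)
    (hμ : μ ∈ SolSet B1 B2 Γ ν) :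
    ∃ F : S2 → S1, Measurable F ∧ ∀ᵐ p ∂μ, p.1 = F p.2 := by
  have hprob := isProbabilityMeasure_of_mem_solSet hμ
  have : Nonempty S1 := (nonempty_of_isProbabilityMeasure μ).map Prod.fst
  obtain ⟨κ, hκ, rfl⟩ := exists_kernel_of_mem_solSet hμ
  obtain ⟨F, hF, h⟩ := exists_measurable_of_ae_eq ν κ <| by
    filter_upwards [ae_ae_of_ae_compProd (hpu.ae_eq_compProd_prod κ κ hμ hμ)] with y hy
    rw [Kernel.prod_apply] at hy
    exact ae_ae_of_ae_prod hy
  refine ⟨F, hF, ?_⟩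
  rw [ae_map_iff measurable_swap.aemeasurable (measurableSet_eq_comp_snd hF)]
  exact ae_compProd_of_ae_ae
    (measurableSet_eq_fun measurable_snd (hF.comp measurable_fst)) h

lemma ae_eq_comp_of_map_eq {F : S2 → S1}
    (h : ∀ᵐ p ∂μ, p.1 = F p.2) {Ω : Type} {mΩ : MeasurableSpace Ω} {P : Measure Ω}
    {ξ : Ω → S1} {η : Ω → S2} (hξ : Measurable ξ) (hη : Measurable η)
    (hμ : P.map (fun ω => (ξ ω, η ω)) = μ) : ξ =ᵐ[P] fun ω => F (η ω) := by
  subst hμ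
  exact ae_of_ae_map (hξ.prodMk hη).aemeasurable h

lemma ae_eq_of_map_ae_eq [StandardBorelSpace S1] {F : S2 → S1} (hF : Measurable F)
    {Ω : Type} {mΩ : MeasurableSpace Ω} {P : Measure Ω}
    {ξ : Ω → S1} {η : Ω → S2} (hξ : Measurable ξ) (hη : Measurable η)
    (h : ξ =ᵐ[P] fun ω => F (η ω)) :
    ∀ᵐ p ∂(P.map fun ω => (ξ ω, η ω)), p.1 = F p.2 := by
  rw [ae_map_iff (hξ.prodMk hη).aemeasurable (measurableSet_eq_comp_snd hF)]
  exact h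

/-- A law concentrated on the graph of `F` is the image of its second marginal under
`y ↦ (F y, y)`. -/
lemma map_graph_snd_eq {F : S2 → S1} (hF : Measurable F) (h : ∀ᵐ p ∂μ, p.1 = F p.2) :
    (μ.map Prod.snd).map (fun y => (F y, y)) = μ := by
  rw [map_map (by fun_prop) measurable_snd]
  conv_rhs => rw [← map_id (μ := μ)]
  refine map_congr ?_
  filter_upwards [h] with p hp
  exact Prod.ext hp.symm rfl

lemma isStrongSolution_comp {F : S2 → S1} (hF : Measurable F) (hμ : μ ∈ SolSet B1 B2 Γ ν)
    (h : ∀ᵐ p ∂μ, p.1 = F p.2) {Ω : Type} {mΩ : MeasurableSpace Ω} {P : Measure Ω}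
    {η : Ω → S2} (hP : IsProbabilityMeasure P) (hη : Measurable η) (hν : P.map η = ν) :
    IsStrongSolution B1 B2 Γ ν mΩ P (fun ω => F (η ω)) η := by
  refine ⟨⟨hP, hF.comp hη, hη, ?_⟩, F, hF, Filter.EventuallyEq.rfl⟩
  have hlaw : P.map (fun ω => (F (η ω), η ω)) = μ := by
    rw [← map_graph_snd_eq hF h, hμ.1, ← hν, map_map (by fun_prop) hη]
    rfl
  rwa [hlaw]

lemma pointwiseUniqueness_of_ae_eq {F : S2 → S1}
    (h : ∀ (Ω : Type) (mΩ : MeasurableSpace Ω) (P : @Measure Ω mΩ) (ξ : Ω → S1) (η : Ω → S2),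
      IsWeakSolution B1 B2 Γ ν mΩ P ξ η → ξ =ᵐ[P] fun ω => F (η ω)) :
    PointwiseUniqueness B1 B2 Γ ν :=
  fun Ω mΩ P ξ ξ' η hw hw' => (h Ω mΩ P ξ η hw).trans (h Ω mΩ P ξ' η hw').symm

end Solutions

/-- **The Yamada–Watanabe–Engelbert theorem** (Kurtz): equivalence of
(a) weak existence plus pointwise uniqueness,
(b) existence of a strong solution plus joint uniqueness in law,
(c) joint uniqueness in law together with a single measurable solution map `F` producing strong
solutions for every probability space and every `η` with law `ν`, such that every weak solution
satisfies `ξ = F (η)` a.s. -/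
theorem yamada_watanabe_engelbert
    [mS1 : MeasurableSpace S1] [TopologicalSpace S1] [PolishSpace S1] [BorelSpace S1]
    [mS2 : MeasurableSpace S2] [TopologicalSpace S2] [PolishSpace S2] [BorelSpace S2]
    (B1 : A → MeasurableSpace S1) (B2 : A → MeasurableSpace S2)
    (hB1 : ∀ α, B1 α ≤ mS1) (hB2 : ∀ α, B2 α ≤ mS2)
    (Γ : Set (Measure (S1 × S2))) (ν : Measure S2) [IsProbabilityMeasure ν] :
    ((((SolSet B1 B2 Γ ν).Nonempty ∧ PointwiseUniqueness B1 B2 Γ ν) ↔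
      ((∃ (Ω : Type) (mΩ : MeasurableSpace Ω) (P : @Measure Ω mΩ)
          (ξ : Ω → S1) (η : Ω → S2), IsStrongSolution B1 B2 Γ ν mΩ P ξ η) ∧
        (SolSet B1 B2 Γ ν).Subsingleton))
    ∧
    (((SolSet B1 B2 Γ ν).Nonempty ∧ PointwiseUniqueness B1 B2 Γ ν) ↔
      ((SolSet B1 B2 Γ ν).Nonempty ∧ (SolSet B1 B2 Γ ν).Subsingleton ∧
        ∃ F : S2 → S1, Measurable F ∧
          (∀ (Ω : Type) (mΩ : MeasurableSpace Ω) (P : @Measure Ω mΩ) (η : Ω → S2),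
            IsProbabilityMeasure P → (@Measurable Ω S2 mΩ _ η) → P.map η = ν →
              IsStrongSolution B1 B2 Γ ν mΩ P (fun ω => F (η ω)) η) ∧
          (∀ (Ω : Type) (mΩ : MeasurableSpace Ω) (P : @Measure Ω mΩ)
              (ξ : Ω → S1) (η : Ω → S2),
            IsWeakSolution B1 B2 Γ ν mΩ P ξ η → ξ =ᵐ[P] fun ω => F (η ω))))) := by
  have ha_c : (SolSet B1 B2 Γ ν).Nonempty ∧ PointwiseUniqueness B1 B2 Γ ν →
      ∃ μ ∈ SolSet B1 B2 Γ ν, (SolSet B1 B2 Γ ν).Subsingleton ∧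
        ∃ F : S2 → S1, Measurable F ∧ ∀ᵐ p ∂μ, p.1 = F p.2 :=
    fun ⟨⟨μ, hμ⟩, hpu⟩ => ⟨μ, hμ, hpu.subsingleton_solSet, hpu.exists_measurable_ae_eq hμ⟩
  refine ⟨⟨fun ha => ?_, ?_⟩, ⟨fun ha => ?_, ?_⟩⟩
  · obtain ⟨μ, hμ, hsub, F, hF, h⟩ := ha_c ha
    exact ⟨⟨S2, mS2, ν, F, id, isStrongSolution_comp hF hμ h inferInstance measurable_id map_id⟩,
      hsub⟩
  · rintro ⟨⟨Ω, mΩ, P, ξ, η, ⟨hP, hξ, hη, hμ⟩, F, hF, h⟩, hsub⟩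
    refine ⟨⟨_, hμ⟩, pointwiseUniqueness_of_ae_eq (F := F) ?_⟩
    rintro Ω' mΩ' P' ξ' η' ⟨-, hξ', hη', hμ'⟩
    exact ae_eq_comp_of_map_eq (ae_eq_of_map_ae_eq hF hξ hη h) hξ' hη' (hsub hμ' hμ)
  · obtain ⟨μ, hμ, hsub, F, hF, h⟩ := ha_c ha
    exact ⟨ha.1, hsub, F, hF,
      fun Ω mΩ P η hP hη hν => isStrongSolution_comp hF hμ h hP hη hν,
      fun Ω mΩ P ξ η hw => ae_eq_comp_of_map_eq h hw.2.1 hw.2.2.1 (hsub hw.2.2.2 hμ)⟩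
  · rintro ⟨hne, -, F, -, -, h⟩
    exact ⟨hne, pointwiseUniqueness_of_ae_eq h⟩

end YWE
end

section
/- Pointwise uniqueness for jointly C-compatible solutions is equivalent to pointwise uniqueness for C-compatible solutions. Precisely, the following are equivalent: (i) whenever ξ, ξ' : Ω → S1 and η : Ω → S2 are random variables on one probability space with law(ξ,η) ∈ S_{Γ,C,ν}, law(ξ',η) ∈ S_{Γ,C,ν} and (ξ,ξ') jointly C-compatible with η, then ξ = ξ' a.s.; (ii) whenever ξ, ξ' : Ω → S1 and η : Ω → S2 are random variables on one probability space with law(ξ,η) ∈ S_{Γ,C,ν} and law(ξ',η) ∈ S_{Γ,C,ν}, then ξ = ξ' a.s. -/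
open MeasureTheory

namespace YWE1

/-!
Pointwise uniqueness for jointly `𝒞`-compatible solutions is equivalent to pointwise uniqueness
for `𝒞`-compatible solutions (Corollary 1.5 / Kurtz Lemma 2.10).  As explained in the paper,
augmenting the conditioning σ-algebras with `P`-null sets does not change conditional
expectations up to a.e. equality, so (joint) compatibility is stated with the σ-algebras
generated by the random variables.
-/

variable {S1 S2 A : Type}

/-- `ξ` is `𝒞`-compatible with `η`. -/
def Compatible [MeasurableSpace S1] [MeasurableSpace S2] {Ω : Type}
    (B1 : A → MeasurableSpace S1) (B2 : A → MeasurableSpace S2)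
    (mΩ : MeasurableSpace Ω) (P : @Measure Ω mΩ) (ξ : Ω → S1) (η : Ω → S2) : Prop :=
  ∀ h : S2 → ℝ, Measurable h → (∃ C : ℝ, ∀ x, |h x| ≤ C) → ∀ α : A,
    P[(fun ω => h (η ω)) | (B1 α).comap ξ ⊔ (B2 α).comap η]
      =ᵐ[P] P[(fun ω => h (η ω)) | (B2 α).comap η]

/-- `(ξ₁, ξ₂)` is jointly `𝒞`-compatible with `η`. -/
def JointlyCompatible [MeasurableSpace S1] [MeasurableSpace S2] {Ω : Type}
    (B1 : A → MeasurableSpace S1) (B2 : A → MeasurableSpace S2)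
    (mΩ : MeasurableSpace Ω) (P : @Measure Ω mΩ)
    (ξ₁ ξ₂ : Ω → S1) (η : Ω → S2) : Prop :=
  ∀ h : S2 → ℝ, Measurable h → (∃ C : ℝ, ∀ x, |h x| ≤ C) → ∀ α : A,
    P[(fun ω => h (η ω)) | (B1 α).comap ξ₁ ⊔ (B1 α).comap ξ₂ ⊔ (B2 α).comap η]
      =ᵐ[P] P[(fun ω => h (η ω)) | (B2 α).comap η]

/-- The measure `μ` on `S1 × S2` arises as the joint law of a `𝒞`-compatible pair. -/
def IsCompatiblyRealized [MeasurableSpace S1] [MeasurableSpace S2]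
    (B1 : A → MeasurableSpace S1) (B2 : A → MeasurableSpace S2)
    (μ : Measure (S1 × S2)) : Prop :=
  ∃ (Ω : Type) (mΩ : MeasurableSpace Ω) (P : @Measure Ω mΩ)
    (ξ : Ω → S1) (η : Ω → S2),
      IsProbabilityMeasure P ∧ (@Measurable Ω S1 mΩ _ ξ) ∧ (@Measurable Ω S2 mΩ _ η) ∧
      Compatible B1 B2 mΩ P ξ η ∧ P.map (fun ω => (ξ ω, η ω)) = μ

/-- The set `S_{Γ,𝒞,ν}` of weak-solution laws. -/
def SolSet [MeasurableSpace S1] [MeasurableSpace S2]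
    (B1 : A → MeasurableSpace S1) (B2 : A → MeasurableSpace S2)
    (Γ : Set (Measure (S1 × S2))) (ν : Measure S2) : Set (Measure (S1 × S2)) :=
  {μ | μ.map Prod.snd = ν ∧ μ ∈ Γ ∧ IsCompatiblyRealized B1 B2 μ}

/-- `(ξ, η)` is a weak solution for `(Γ, 𝒞, ν)`. -/
def IsWeakSolution [MeasurableSpace S1] [MeasurableSpace S2]
    (B1 : A → MeasurableSpace S1) (B2 : A → MeasurableSpace S2)
    (Γ : Set (Measure (S1 × S2))) (ν : Measure S2)
    {Ω : Type} (mΩ : MeasurableSpace Ω) (P : @Measure Ω mΩ)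
    (ξ : Ω → S1) (η : Ω → S2) : Prop :=
  IsProbabilityMeasure P ∧ (@Measurable Ω S1 mΩ _ ξ) ∧ (@Measurable Ω S2 mΩ _ η) ∧
    P.map (fun ω => (ξ ω, η ω)) ∈ SolSet B1 B2 Γ ν

open ProbabilityTheory Filter

section CondExp

variable {Ω E : Type*}

/-- Conditional expectation is self-adjoint on bounded functions. -/
lemma integral_mul_condExp_eq_integral_condExp_mul {m m0 : MeasurableSpace Ω} {μ : Measure Ω}
    [IsFiniteMeasure μ] (hm : m ≤ m0) {f g : Ω → ℝ} (hf : Integrable f μ) (hg : Integrable g μ)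
    {a b : ℝ} (ha : ∀ x, |f x| ≤ a) (hb : ∀ x, |g x| ≤ b) :
    ∫ x, f x * (μ[g | m]) x ∂μ = ∫ x, (μ[f | m]) x * g x ∂μ := by
  have hl : ∫ x, f x * (μ[g | m]) x ∂μ = ∫ x, (μ[f | m]) x * (μ[g | m]) x ∂μ := by
    have hint : Integrable (f * μ[g | m]) μ :=
      integrable_condExp.bdd_mul hf.aestronglyMeasurable (c := a) (.of_forall ha)
    have h := condExp_mul_of_aestronglyMeasurable_right
      stronglyMeasurable_condExp.aestronglyMeasurable hint hf
    rw [← integral_condExp hm (f := fun x => f x * (μ[g | m]) x)]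
    exact integral_congr_ae h
  have hr : ∫ x, (μ[f | m]) x * g x ∂μ = ∫ x, (μ[f | m]) x * (μ[g | m]) x ∂μ := by
    have hint : Integrable (μ[f | m] * g) μ :=
      integrable_condExp.mul_bdd hg.aestronglyMeasurable (c := b) (.of_forall hb)
    have h := condExp_mul_of_aestronglyMeasurable_left
      stronglyMeasurable_condExp.aestronglyMeasurable hint hg
    rw [← integral_condExp hm (f := fun x => (μ[f | m]) x * g x)]
    exact integral_congr_ae h
  rw [hl, hr]

/-- If testing against bounded functions does not see the projection onto `m`, then the function
is `m`-measurable up to a null set. -/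
lemma aestronglyMeasurable_of_forall_integral_mul_condExp_eq {m m0 : MeasurableSpace Ω}
    {μ : Measure Ω} [IsFiniteMeasure μ] (hm : m ≤ m0) {k : Ω → ℝ} (hk : Integrable k μ)
    {b : ℝ} (hb : ∀ x, |k x| ≤ b)
    (H : ∀ h : Ω → ℝ, Measurable h → (∃ C : ℝ, ∀ x, |h x| ≤ C) →
      ∫ x, h x * k x ∂μ = ∫ x, (μ[h | m]) x * k x ∂μ) :
    AEStronglyMeasurable[m] k μ := by
  have hae : k =ᵐ[μ] μ[k | m] := by
    refine Integrable.ae_eq_of_forall_setIntegral_eq _ _ hk integrable_condExp fun s hs _ => ?_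
    have hbd : ∀ x, |s.indicator (fun _ => (1 : ℝ)) x| ≤ 1 := fun x => by
      by_cases hx : x ∈ s <;> simp [hx]
    have hmul : ∀ u : Ω → ℝ,
        ∫ x in s, u x ∂μ = ∫ x, s.indicator (fun _ => (1 : ℝ)) x * u x ∂μ := fun u => by
      rw [← integral_indicator hs]
      congr with x
      by_cases hx : x ∈ s <;> simp [hx]
    rw [hmul, hmul, H _ (measurable_const.indicator hs) ⟨1, hbd⟩,
      integral_mul_condExp_eq_integral_condExp_mul hm ((integrable_const 1).indicator hs) hk
        hbd hb]
  exact (stronglyMeasurable_condExp.aestronglyMeasurable).congr hae.symm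

/-- Conditioning on a pulled-back σ-algebra amounts to conditioning under the law. -/
lemma condExp_comp_comap {m : MeasurableSpace E} [mE : MeasurableSpace E]
    [mΩ : MeasurableSpace Ω] {P : Measure Ω}
    [IsFiniteMeasure P] {Y : Ω → E} (hY : Measurable Y) (hm : m ≤ mE)
    {h : E → ℝ} (hh : Integrable h (P.map Y)) :
    (fun ω => ((P.map Y)[h | m]) (Y ω)) =ᵐ[P] P[(fun ω => h (Y ω)) | m.comap Y] := by
  have hle : m.comap Y ≤ mΩ := (MeasurableSpace.comap_mono hm).trans hY.comap_le
  have hsm : StronglyMeasurable[m] ((P.map Y)[h | m]) := stronglyMeasurable_condExp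
  refine ae_eq_condExp_of_forall_setIntegral_eq hle (hh.comp_measurable hY) ?_ ?_ ?_
  · intro s _ _
    exact (integrable_condExp.comp_measurable hY).integrableOn
  · rintro _ ⟨t, ht, rfl⟩ _
    rw [← setIntegral_map (hm t ht) integrable_condExp.aestronglyMeasurable hY.aemeasurable,
      setIntegral_condExp hm hh ht,
      setIntegral_map (hm t ht) hh.aestronglyMeasurable hY.aemeasurable]
  · exact (hsm.comp_measurable (comap_measurable Y)).aestronglyMeasurable

/-- A conditional expectation may be identified by testing on a π-system. -/
lemma ae_eq_condExp_of_isPiSystem {m m0 : MeasurableSpace Ω} {μ : Measure Ω}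
    [IsFiniteMeasure μ] (hm : m ≤ m0) {s : Set (Set Ω)}
    (hgen : m = MeasurableSpace.generateFrom s) (hpi : IsPiSystem s) {f g : Ω → ℝ}
    (hf : Integrable f μ) (hg : Integrable g μ) (huniv : ∫ x, g x ∂μ = ∫ x, f x ∂μ)
    (hbasic : ∀ t ∈ s, ∫ x in t, g x ∂μ = ∫ x in t, f x ∂μ) (hgm : AEStronglyMeasurable[m] g μ) :
    g =ᵐ[μ] μ[f | m] := by
  refine ae_eq_condExp_of_forall_setIntegral_eq hm hf (fun _ _ _ => hg.integrableOn) ?_ hgm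
  intro t ht _
  induction t, ht using MeasurableSpace.induction_on_inter hgen hpi with
  | empty => simp
  | basic t ht => exact hbasic t ht
  | compl t ht ih =>
    have h1 := integral_add_compl (hm t ht) hf
    have h2 := integral_add_compl (hm t ht) hg
    have := ih (measure_lt_top _ _)
    linarith
  | iUnion F hd hF ih =>
    rw [integral_iUnion (fun i => hm _ (hF i)) hd hg.integrableOn,
      integral_iUnion (fun i => hm _ (hF i)) hd hf.integrableOn]
    exact tsum_congr fun i => ih i (measure_lt_top _ _)

/-- Integrals over a rectangle in terms of a disintegration of the joint law. -/
lemma setIntegral_preimage_eq_integral_mul_kernel {T : Type*} [MeasurableSpace T]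
    [MeasurableSpace E] [MeasurableSpace Ω] {P : Measure Ω} {X : Ω → E} {Y : Ω → T}
    (hX : Measurable X) (hY : Measurable Y) {ν : Measure T} [IsFiniteMeasure ν]
    {κ : Kernel T E} [IsMarkovKernel κ] (hlaw : P.map (fun ω => (Y ω, X ω)) = ν ⊗ₘ κ)
    {B : Set E} (hB : MeasurableSet B) {h : T → ℝ} (hh : Measurable h) (hi : Integrable h ν) :
    ∫ ω in X ⁻¹' B, h (Y ω) ∂P = ∫ y, h y * (κ y).real B ∂ν := by
  have hYX : Measurable fun ω => (Y ω, X ω) := hY.prodMk hX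
  have hpre : X ⁻¹' B = (fun ω => (Y ω, X ω)) ⁻¹' (Set.univ ×ˢ B) := by ext; simp
  have hint : Integrable (fun p : T × E => h p.1) (ν ⊗ₘ κ) := by
    refine Integrable.comp_measurable (f := Prod.fst) (g := h) ?_ measurable_fst
    change Integrable h (ν ⊗ₘ κ).fst
    rwa [Measure.fst_compProd]
  rw [hpre, ← setIntegral_map (f := fun p : T × E => h p.1) (MeasurableSet.univ.prod hB)
    (hh.comp measurable_fst).aestronglyMeasurable hYX.aemeasurable, hlaw,
    Measure.setIntegral_compProd MeasurableSet.univ hB hint.integrableOn]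
  simp [mul_comm]

end CondExp

/-- If independent copies of the marginals of `ρ` agree almost surely, then `ρ` is carried by the
diagonal. -/
lemma ae_fst_eq_snd_of_ae_prod {E : Type*} [MeasurableSpace E] {ρ : Measure (E × E)}
    [IsProbabilityMeasure ρ] (h : ∀ᵐ p ∂(ρ.fst.prod ρ.snd), p.1 = p.2) :
    ∀ᵐ p ∂ρ, p.1 = p.2 := by
  have h' := Measure.ae_ae_of_ae_prod h
  obtain ⟨x₀, hx₀⟩ := h'.exists
  have hfst : ∀ᵐ x ∂ρ.fst, x = x₀ := by
    filter_upwards [h'] with x hx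
    obtain ⟨z, hz, hz'⟩ := (hx.and hx₀).exists
    exact hz.trans hz'.symm
  filter_upwards [ae_of_ae_map measurable_fst.aemeasurable hfst,
    ae_of_ae_map measurable_snd.aemeasurable hx₀] with p h1 h2
  exact h1.trans h2

/-- Compatibility forces the disintegration kernel to be adapted, up to null sets. -/
lemma Compatible.aestronglyMeasurable_kernel [mS1 : MeasurableSpace S1] [mS2 : MeasurableSpace S2]
    {B1 : A → MeasurableSpace S1} {B2 : A → MeasurableSpace S2}
    (hB1 : ∀ α, B1 α ≤ mS1) (hB2 : ∀ α, B2 α ≤ mS2)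
    {Ω : Type} [mΩ : MeasurableSpace Ω] {P : Measure Ω} [IsProbabilityMeasure P]
    {ξ : Ω → S1} {η : Ω → S2} (hξ : Measurable ξ) (hη : Measurable η)
    (hc : Compatible B1 B2 mΩ P ξ η) {ν : Measure S2} [IsProbabilityMeasure ν]
    {κ : Kernel S2 S1} [IsMarkovKernel κ] (hlaw : P.map (fun ω => (η ω, ξ ω)) = ν ⊗ₘ κ)
    (α : A) {B : Set S1} (hB : MeasurableSet[B1 α] B) :
    AEStronglyMeasurable[B2 α] (fun y => (κ y).real B) ν := by
  have hν : P.map η = ν := by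
    rw [← Measure.fst_map_prodMk (X := η) hξ, hlaw, Measure.fst_compProd]
  have hkm : Measurable fun y => (κ y).real B := (κ.measurable_coe (hB1 α B hB)).ennreal_toReal
  have hkb : ∀ y, |(κ y).real B| ≤ 1 := fun y => by
    rw [abs_of_nonneg measureReal_nonneg]; exact measureReal_le_one
  refine aestronglyMeasurable_of_forall_integral_mul_condExp_eq (hB2 α)
    (.of_bound hkm.aestronglyMeasurable 1 (.of_forall hkb)) hkb fun h hh hbd => ?_
  have hhi : Integrable h ν := by
    obtain ⟨C, hC⟩ := hbd
    exact .of_bound hh.aestronglyMeasurable C (.of_forall hC)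
  have hsm : StronglyMeasurable[B2 α] (ν[h | B2 α]) := stronglyMeasurable_condExp
  rw [← setIntegral_preimage_eq_integral_mul_kernel hξ hη hlaw (hB1 α B hB) hh hhi,
    ← setIntegral_preimage_eq_integral_mul_kernel hξ hη hlaw (hB1 α B hB)
      (hsm.mono (hB2 α)).measurable integrable_condExp]
  subst hν
  have hle : (B1 α).comap ξ ⊔ (B2 α).comap η ≤ mΩ :=
    sup_le ((MeasurableSpace.comap_mono (hB1 α)).trans hξ.comap_le)
      ((MeasurableSpace.comap_mono (hB2 α)).trans hη.comap_le)
  have hs : MeasurableSet[(B1 α).comap ξ ⊔ (B2 α).comap η] (ξ ⁻¹' B) :=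
    (le_sup_left : (B1 α).comap ξ ≤ _) _ ⟨B, hB, rfl⟩
  rw [← setIntegral_condExp (f := fun ω => h (η ω)) hle (hhi.comp_measurable hη) hs]
  refine integral_congr_ae (ae_restrict_of_ae ?_)
  exact (hc h hh hbd α).trans (condExp_comp_comap hη (hB2 α) hhi).symm

/-- Gluing two adapted kernels conditionally independently gives a jointly compatible pair. -/
lemma jointlyCompatible_compProd_prod [mS1 : MeasurableSpace S1] [mS2 : MeasurableSpace S2]
    {B1 : A → MeasurableSpace S1} {B2 : A → MeasurableSpace S2}
    (hB1 : ∀ α, B1 α ≤ mS1) (hB2 : ∀ α, B2 α ≤ mS2)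
    {ν : Measure S2} [IsProbabilityMeasure ν]
    {κ₁ κ₂ : Kernel S2 S1} [IsMarkovKernel κ₁] [IsMarkovKernel κ₂]
    (h₁ : ∀ α B, MeasurableSet[B1 α] B → AEStronglyMeasurable[B2 α] (fun y => (κ₁ y).real B) ν)
    (h₂ : ∀ α B, MeasurableSet[B1 α] B → AEStronglyMeasurable[B2 α] (fun y => (κ₂ y).real B) ν) :
    JointlyCompatible B1 B2 inferInstance (ν ⊗ₘ (κ₁ ×ₖ κ₂))
      (fun p : S2 × S1 × S1 => p.2.1) (fun p => p.2.2) (fun p => p.1) := by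
  intro h hh hbd α
  set Q := ν ⊗ₘ (κ₁ ×ₖ κ₂) with hQ
  have hη : Measurable (fun p : S2 × S1 × S1 => p.1) := measurable_fst
  have hν : Q.map (fun p => p.1) = ν := Measure.fst_compProd ν _
  have hhi : Integrable h ν := by
    obtain ⟨C, hC⟩ := hbd
    exact .of_bound hh.aestronglyMeasurable C (.of_forall hC)
  have hproj := condExp_comp_comap (P := Q) hη (hB2 α) (h := h) (by rwa [hν])
  rw [hν] at hproj
  refine EventuallyEq.trans (EventuallyEq.symm ?_) hproj
  set m : MeasurableSpace (S2 × S1 × S1) := (B1 α).comap (fun p => p.2.1) ⊔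
    (B1 α).comap (fun p => p.2.2) ⊔ (B2 α).comap (fun p => p.1) with hmdef
  have hle1 : (B1 α).comap (fun p : S2 × S1 × S1 => p.2.1) ≤ m := le_sup_left.trans le_sup_left
  have hle2 : (B1 α).comap (fun p : S2 × S1 × S1 => p.2.2) ≤ m := le_sup_right.trans le_sup_left
  have hle3 : (B2 α).comap (fun p : S2 × S1 × S1 => p.1) ≤ m := le_sup_right
  have hm : m ≤ Prod.instMeasurableSpace := by
    refine sup_le (sup_le ?_ ?_) ?_
    · exact (MeasurableSpace.comap_mono (hB1 α)).trans
        (measurable_fst.comp measurable_snd).comap_le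
    · exact (MeasurableSpace.comap_mono (hB1 α)).trans
        (measurable_snd.comp measurable_snd).comap_le
    · exact (MeasurableSpace.comap_mono (hB2 α)).trans measurable_fst.comap_le
  have hsm : StronglyMeasurable[B2 α] (ν[h | B2 α]) := stronglyMeasurable_condExp
  have hcomp : ∀ {u : S2 → ℝ}, Integrable u ν → Integrable (fun p => u p.1) Q := fun {u} hu =>
    Integrable.comp_measurable (f := fun p : S2 × S1 × S1 => p.1) (g := u) (by rwa [hν]) hη
  have hrect : ∀ C D₁ D₂, MeasurableSet[B2 α] C → MeasurableSet[B1 α] D₁ →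
      MeasurableSet[B1 α] D₂ →
      ∫ p in C ×ˢ D₁ ×ˢ D₂, (ν[h | B2 α]) p.1 ∂Q = ∫ p in C ×ˢ D₁ ×ˢ D₂, h p.1 ∂Q := by
    intro C D₁ D₂ hC hD₁ hD₂
    set w : S2 → ℝ := C.indicator fun y => (κ₁ y).real D₁ * (κ₂ y).real D₂ with hw
    have hcalc : ∀ u : S2 → ℝ, Measurable u → Integrable u ν →
        ∫ p in C ×ˢ D₁ ×ˢ D₂, u p.1 ∂Q = ∫ y, w y * u y ∂ν := by
      intro u hu hui
      rw [hQ, Measure.setIntegral_compProd (hB2 α C hC) ((hB1 α _ hD₁).prod (hB1 α _ hD₂))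
        (hcomp hui).integrableOn, ← integral_indicator (hB2 α C hC)]
      congr with y
      by_cases hy : y ∈ C <;>
        simp [hy, hw, measureReal_def, Kernel.prod_apply_prod, ENNReal.toReal_mul]
    have hwm : AEStronglyMeasurable[B2 α] w ν := by
      obtain ⟨v, hv, hvae⟩ := (h₁ α D₁ hD₁).mul (h₂ α D₂ hD₂)
      exact ⟨C.indicator v, hv.indicator hC, hvae.indicator⟩
    have hwb : ∀ y, ‖w y‖ ≤ 1 := fun y => by
      by_cases hy : y ∈ C
      · simp only [hw, hy, Set.indicator_of_mem, norm_mul, Real.norm_eq_abs,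
          abs_of_nonneg measureReal_nonneg]
        exact mul_le_one₀ measureReal_le_one measureReal_nonneg measureReal_le_one
      · simp [hw, hy]
    rw [hcalc _ (hsm.mono (hB2 α)).measurable integrable_condExp, hcalc h hh hhi,
      ← integral_condExp (hB2 α) (f := fun y => w y * h y)]
    exact integral_congr_ae
      (condExp_stronglyMeasurable_mul_of_bound₀ (hB2 α) hwm hhi 1 (.of_forall hwb)).symm
  refine ae_eq_condExp_of_isPiSystem hm
    (s := {t | ∃ C D₁ D₂, MeasurableSet[B2 α] C ∧ MeasurableSet[B1 α] D₁ ∧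
      MeasurableSet[B1 α] D₂ ∧ t = C ×ˢ D₁ ×ˢ D₂}) ?_ ?_ (hcomp hhi)
    (hcomp integrable_condExp) ?_ ?_ ?_
  · refine le_antisymm (sup_le (sup_le ?_ ?_) ?_) (MeasurableSpace.generateFrom_le ?_)
    · rintro _ ⟨D, hD, rfl⟩
      exact MeasurableSpace.measurableSet_generateFrom
        ⟨Set.univ, D, Set.univ, .univ, hD, .univ, by ext; simp⟩
    · rintro _ ⟨D, hD, rfl⟩
      exact MeasurableSpace.measurableSet_generateFrom
        ⟨Set.univ, Set.univ, D, .univ, .univ, hD, by ext; simp⟩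
    · rintro _ ⟨C, hC, rfl⟩
      exact MeasurableSpace.measurableSet_generateFrom
        ⟨C, Set.univ, Set.univ, hC, .univ, .univ, by ext; simp⟩
    · rintro _ ⟨C, D₁, D₂, hC, hD₁, hD₂, rfl⟩
      exact MeasurableSet.inter (m := m) (hle3 _ ⟨C, hC, rfl⟩)
        (MeasurableSet.inter (m := m) (hle1 _ ⟨D₁, hD₁, rfl⟩) (hle2 _ ⟨D₂, hD₂, rfl⟩))
  · rintro _ ⟨C, D₁, D₂, hC, hD₁, hD₂, rfl⟩ _ ⟨C', D₁', D₂', hC', hD₁', hD₂', rfl⟩ _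
    exact ⟨C ∩ C', D₁ ∩ D₁', D₂ ∩ D₂', MeasurableSet.inter (m := B2 α) hC hC',
      MeasurableSet.inter (m := B1 α) hD₁ hD₁', MeasurableSet.inter (m := B1 α) hD₂ hD₂',
      by rw [Set.prod_inter_prod, Set.prod_inter_prod]⟩
  · simpa using hrect Set.univ Set.univ Set.univ .univ .univ .univ
  · rintro _ ⟨C, D₁, D₂, hC, hD₁, hD₂, rfl⟩
    exact hrect C D₁ D₂ hC hD₁ hD₂
  · exact ((hsm.comp_measurable (comap_measurable (fun p : S2 × S1 × S1 => p.1))).mono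
      hle3).aestronglyMeasurable

/-- A law in the solution set has an adapted disintegration kernel. -/
lemma aestronglyMeasurable_kernel_of_mem_solSet [mS1 : MeasurableSpace S1]
    [mS2 : MeasurableSpace S2] {B1 : A → MeasurableSpace S1} {B2 : A → MeasurableSpace S2}
    (hB1 : ∀ α, B1 α ≤ mS1) (hB2 : ∀ α, B2 α ≤ mS2)
    {Γ : Set (Measure (S1 × S2))} {ν : Measure S2} [IsProbabilityMeasure ν]
    {κ : Kernel S2 S1} [IsMarkovKernel κ] (hμ : (ν ⊗ₘ κ).map Prod.swap ∈ SolSet B1 B2 Γ ν)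
    (α : A) (B : Set S1) (hB : MeasurableSet[B1 α] B) :
    AEStronglyMeasurable[B2 α] (fun y => (κ y).real B) ν := by
  obtain ⟨-, -, Ω, mΩ, P, ξ, η, hP, hξ, hη, hc, hlaw⟩ := hμ
  refine hc.aestronglyMeasurable_kernel hB1 hB2 hξ hη ?_ α hB
  have := congrArg (Measure.map Prod.swap) hlaw
  rw [Measure.map_map measurable_swap (hξ.prodMk hη),
    Measure.map_map measurable_swap measurable_swap, Prod.swap_swap_eq, Measure.map_id] at this
  exact this

/-- **Corollary.**  Pointwise uniqueness for jointly `𝒞`-compatible weak solutions is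
equivalent to pointwise uniqueness for (all) weak solutions. -/
theorem pointwiseUniqueness_jointlyCompatible_iff
    [mS1 : MeasurableSpace S1] [TopologicalSpace S1] [PolishSpace S1] [BorelSpace S1]
    [mS2 : MeasurableSpace S2] [TopologicalSpace S2] [PolishSpace S2] [BorelSpace S2]
    (B1 : A → MeasurableSpace S1) (B2 : A → MeasurableSpace S2)
    (hB1 : ∀ α, B1 α ≤ mS1) (hB2 : ∀ α, B2 α ≤ mS2)
    (Γ : Set (Measure (S1 × S2))) (ν : Measure S2) [IsProbabilityMeasure ν] :
    (∀ (Ω : Type) (mΩ : MeasurableSpace Ω) (P : @Measure Ω mΩ)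
        (ξ ξ' : Ω → S1) (η : Ω → S2),
      IsWeakSolution B1 B2 Γ ν mΩ P ξ η → IsWeakSolution B1 B2 Γ ν mΩ P ξ' η →
      JointlyCompatible B1 B2 mΩ P ξ ξ' η → ξ =ᵐ[P] ξ')
    ↔
    (∀ (Ω : Type) (mΩ : MeasurableSpace Ω) (P : @Measure Ω mΩ)
        (ξ ξ' : Ω → S1) (η : Ω → S2),
      IsWeakSolution B1 B2 Γ ν mΩ P ξ η → IsWeakSolution B1 B2 Γ ν mΩ P ξ' η →
      ξ =ᵐ[P] ξ') := by
  refine ⟨fun H Ω mΩ P ξ ξ' η hw hw' => ?_,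
    fun H Ω mΩ P ξ ξ' η hw hw' _ => H Ω mΩ P ξ ξ' η hw hw'⟩
  obtain ⟨hP, hξ, hη, hsol⟩ := hw
  obtain ⟨-, hξ', -, hsol'⟩ := hw'
  have hν : P.map η = ν := by
    rw [← hsol.1, Measure.map_map measurable_snd (hξ.prodMk hη)]
    rfl
  have : Nonempty S1 := P.nonempty_of_neZero.map ξ
  set κ : Kernel S2 (S1 × S1) := condDistrib (fun ω => (ξ ω, ξ' ω)) η P with hκ
  have hκlaw : P.map (fun ω => (η ω, (ξ ω, ξ' ω))) = ν ⊗ₘ κ := by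
    rw [← hν, hκ, compProd_map_condDistrib (hξ.prodMk hξ').aemeasurable]
  -- The laws of both solutions in terms of the marginals of `κ`.
  have hfst : ∀ {κ' : Kernel S2 (S1 × S1)} [IsMarkovKernel κ'],
      (ν ⊗ₘ κ').map (fun p => (p.2.1, p.1)) = (ν ⊗ₘ κ'.fst).map Prod.swap := by
    intro κ' _
    rw [Kernel.fst_eq, Measure.compProd_map measurable_fst,
      Measure.map_map measurable_swap (by fun_prop)]
    rfl
  have hsnd : ∀ {κ' : Kernel S2 (S1 × S1)} [IsMarkovKernel κ'],
      (ν ⊗ₘ κ').map (fun p => (p.2.2, p.1)) = (ν ⊗ₘ κ'.snd).map Prod.swap := by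
    intro κ' _
    rw [Kernel.snd_eq, Measure.compProd_map measurable_snd,
      Measure.map_map measurable_swap (by fun_prop)]
    rfl
  have hlaw : P.map (fun ω => (ξ ω, η ω)) = (ν ⊗ₘ κ.fst).map Prod.swap := by
    rw [← hfst, ← hκlaw, Measure.map_map (by fun_prop) (by fun_prop)]
    rfl
  have hlaw' : P.map (fun ω => (ξ' ω, η ω)) = (ν ⊗ₘ κ.snd).map Prod.swap := by
    rw [← hsnd, ← hκlaw, Measure.map_map (by fun_prop) (by fun_prop)]
    rfl
  rw [hlaw] at hsol
  rw [hlaw'] at hsol'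
  have hcouple := H (S2 × S1 × S1) inferInstance (ν ⊗ₘ (κ.fst ×ₖ κ.snd))
    (fun p => p.2.1) (fun p => p.2.2) (fun p => p.1)
    ⟨inferInstance, by fun_prop, by fun_prop, by
      rw [hfst, Kernel.fst_prod]; exact hsol⟩
    ⟨inferInstance, by fun_prop, by fun_prop, by
      rw [hsnd, Kernel.snd_prod]; exact hsol'⟩
    (jointlyCompatible_compProd_prod hB1 hB2
      (aestronglyMeasurable_kernel_of_mem_solSet hB1 hB2 hsol)
      (aestronglyMeasurable_kernel_of_mem_solSet hB1 hB2 hsol'))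
  have hdiag : ∀ᵐ p ∂(ν ⊗ₘ κ), p.2.1 = p.2.2 := by
    refine Measure.ae_compProd_of_ae_ae
      (measurableSet_eq_fun (by fun_prop) (by fun_prop)) ?_
    filter_upwards [Measure.ae_ae_of_ae_compProd hcouple] with y hy
    refine ae_fst_eq_snd_of_ae_prod ?_
    rwa [Kernel.prod_apply, Kernel.fst_apply, Kernel.snd_apply] at hy
  rw [← hκlaw] at hdiag
  exact ae_of_ae_map (by fun_prop) hdiag

end YWE1
end

section
/- Let (Ω, F, P) be a probability space, let (E1, A1) and (E2, A2) be measurable spaces, and let ξ : Ω → E1 and η : Ω → E2 be measurable. Assume that the diagonal D = {(z, z) : z ∈ E1 × E2} belongs to the product σ-algebra (A1 ⊗ A2) ⊗ (A1 ⊗ A2). If law(ξ, η) = law(F(η), η) for some measurable map F : (E2, A2) → (E1, A1), then ξ = F(η) P-a.s. -/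
open MeasureTheory

/-- **Lemma (identification from equality of laws).**
If the diagonal of `(E1 × E2) × (E1 × E2)` is product-measurable and the joint law of `(ξ, η)`
coincides with that of `(F (η), η)` for a measurable `F`, then `ξ = F (η)` almost surely. -/
theorem eq_comp_of_law_eq
    {Ω E1 E2 : Type*} [MeasurableSpace Ω] [MeasurableSpace E1] [MeasurableSpace E2]
    (P : Measure Ω) [IsProbabilityMeasure P]
    (ξ : Ω → E1) (η : Ω → E2) (hξ : Measurable ξ) (hη : Measurable η)
    (hD : MeasurableSet {p : (E1 × E2) × (E1 × E2) | p.1 = p.2})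
    (F : E2 → E1) (hF : Measurable F)
    (hlaw : P.map (fun ω => (ξ ω, η ω)) = P.map (fun ω => (F (η ω), η ω))) :
    ∀ᵐ ω ∂P, ξ ω = F (η ω) := by
  have hS : MeasurableSet {p : E1 × E2 | p.1 = F p.2} := by
    have hg : Measurable fun p : E1 × E2 => (p, (F p.2, p.2)) := by fun_prop
    convert hg hD using 1
    ext p
    simp [Prod.ext_iff]
  have hae : ∀ᵐ p ∂P.map (fun ω => (ξ ω, η ω)), p.1 = F p.2 := by
    rw [hlaw]
    exact (ae_map_iff ((hF.comp hη).prodMk hη).aemeasurable hS).2 (.of_forall fun _ => rfl)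
  exact (ae_map_iff (hξ.prodMk hη).aemeasurable hS).1 hae
end

section
/- Let S1, S2 be Polish spaces and C a compatibility structure on (S1, S2). Let ξ : Ω → S1 and η : Ω → S2 be random variables on a probability space (Ω, F, P), and let ξ' : Ω' → S1 and η' : Ω' → S2 be random variables on a probability space (Ω', F', P'), such that law(ξ, η) = law(ξ', η'). If ξ is C-compatible with η, then ξ' is C-compatible with η'. -/
open MeasureTheory

namespace YWE3

/-!
`𝒞`-compatibility only depends on the joint law (Remark after Definition 1.2 in the paper).
As explained in the paper, augmenting the conditioning σ-algebras with `P`-null sets does not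
change conditional expectations up to a.e. equality, so compatibility is stated with the
σ-algebras generated by the random variables.
-/

variable {S1 S2 A : Type}

/-- `ξ` is `𝒞`-compatible with `η` for the compatibility structure given by `B1`, `B2`. -/
def Compatible [MeasurableSpace S1] [MeasurableSpace S2] {Ω : Type*} [MeasurableSpace Ω]
    (B1 : A → MeasurableSpace S1) (B2 : A → MeasurableSpace S2)
    (P : Measure Ω) (ξ : Ω → S1) (η : Ω → S2) : Prop :=
  ∀ h : S2 → ℝ, Measurable h → (∃ C : ℝ, ∀ x, |h x| ≤ C) → ∀ α : A,
    P[(fun ω => h (η ω)) | (B1 α).comap ξ ⊔ (B2 α).comap η]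
      =ᵐ[P] P[(fun ω => h (η ω)) | (B2 α).comap η]

/-- Conditional expectations of functions of `X` are computed under the law of `X`. -/
theorem condExp_comap_ae_eq_comp {Ω E : Type*} {m : MeasurableSpace E}
    [mΩ : MeasurableSpace Ω] [mE : MeasurableSpace E]
    {P : Measure Ω} [IsFiniteMeasure P] {X : Ω → E} (hX : Measurable X)
    (hm : m ≤ mE) {f : E → ℝ} (hf : Integrable f (P.map X)) :
    P[f ∘ X | m.comap X] =ᵐ[P] (P.map X)[f | m] ∘ X := by
  have hm' : m.comap X ≤ mΩ := (MeasurableSpace.comap_mono hm).trans hX.comap_le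
  have hg : Integrable ((P.map X)[f | m]) (P.map X) := integrable_condExp
  refine (ae_eq_condExp_of_forall_setIntegral_eq hm' (hf.comp_measurable hX)
    (fun s _ _ => (hg.comp_measurable hX).integrableOn) ?_ ?_).symm
  · rintro _ ⟨t, ht, rfl⟩ -
    simp only [Function.comp_apply]
    rw [← setIntegral_map (hm t ht) hg.aestronglyMeasurable hX.aemeasurable,
      ← setIntegral_map (hm t ht) hf.aestronglyMeasurable hX.aemeasurable,
      setIntegral_condExp hm hf ht]
  · exact (stronglyMeasurable_condExp.comp_measurable
      (comap_measurable X)).aestronglyMeasurable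

/-- Equality of conditional expectations of a function of `X` can be checked under the law
of `X`. -/
theorem condExp_comap_ae_eq_iff {Ω E : Type*} {m₁ m₂ : MeasurableSpace E}
    [MeasurableSpace Ω] [mE : MeasurableSpace E]
    {P : Measure Ω} [IsFiniteMeasure P] {X : Ω → E} (hX : Measurable X)
    (hm₁ : m₁ ≤ mE) (hm₂ : m₂ ≤ mE) {f : E → ℝ}
    (hf : Integrable f (P.map X)) :
    P[f ∘ X | m₁.comap X] =ᵐ[P] P[f ∘ X | m₂.comap X] ↔
      (P.map X)[f | m₁] =ᵐ[P.map X] (P.map X)[f | m₂] := by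
  have h₁ := condExp_comap_ae_eq_comp hX hm₁ hf
  have h₂ := condExp_comap_ae_eq_comp hX hm₂ hf
  have hset : MeasurableSet {x | ((P.map X)[f | m₁]) x = ((P.map X)[f | m₂]) x} :=
    measurableSet_eq_fun (stronglyMeasurable_condExp.mono hm₁).measurable
      (stronglyMeasurable_condExp.mono hm₂).measurable
  exact Iff.trans ⟨fun h => h₁.symm.trans (h.trans h₂), fun h => h₁.trans (h.trans h₂.symm)⟩
    (ae_map_iff hX.aemeasurable hset).symm

/-- **Compatibility is a property of the joint law**: if `law (ξ, η) = law (ξ', η')` and `ξ` is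
`𝒞`-compatible with `η`, then `ξ'` is `𝒞`-compatible with `η'`. -/
theorem compatible_of_law_eq
    [mS1 : MeasurableSpace S1] [TopologicalSpace S1] [PolishSpace S1] [BorelSpace S1]
    [mS2 : MeasurableSpace S2] [TopologicalSpace S2] [PolishSpace S2] [BorelSpace S2]
    (B1 : A → MeasurableSpace S1) (B2 : A → MeasurableSpace S2)
    (hB1 : ∀ α, B1 α ≤ mS1) (hB2 : ∀ α, B2 α ≤ mS2)
    {Ω Ω' : Type*} [MeasurableSpace Ω] [MeasurableSpace Ω']
    (P : Measure Ω) [IsProbabilityMeasure P] (P' : Measure Ω') [IsProbabilityMeasure P']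
    (ξ : Ω → S1) (η : Ω → S2) (ξ' : Ω' → S1) (η' : Ω' → S2)
    (hξ : Measurable ξ) (hη : Measurable η) (hξ' : Measurable ξ') (hη' : Measurable η')
    (hlaw : P.map (fun ω => (ξ ω, η ω)) = P'.map (fun ω => (ξ' ω, η' ω)))
    (hcomp : Compatible B1 B2 P ξ η) :
    Compatible B1 B2 P' ξ' η' := by
  rintro h hh ⟨C, hC⟩ α
  have hX : Measurable fun ω => (ξ ω, η ω) := hξ.prodMk hη
  have hX' : Measurable fun ω => (ξ' ω, η' ω) := hξ'.prodMk hη'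
  have hm₂ : (B2 α).comap Prod.snd ≤ mS1.prod mS2 :=
    (MeasurableSpace.comap_mono (hB2 α)).trans le_sup_right
  have hm₁ : (B1 α).comap Prod.fst ⊔ (B2 α).comap Prod.snd ≤ mS1.prod mS2 :=
    sup_le_sup (MeasurableSpace.comap_mono (hB1 α)) (MeasurableSpace.comap_mono (hB2 α))
  have hint : ∀ (Q : Measure (S1 × S2)) [IsFiniteMeasure Q],
      Integrable (fun p : S1 × S2 => h p.2) Q := fun Q _ =>
    Integrable.of_bound (hh.comp measurable_snd).aestronglyMeasurable C
      (Filter.Eventually.of_forall fun p => hC p.2)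
  have key := condExp_comap_ae_eq_iff (P := P) hX hm₁ hm₂ (hint _)
  have key' := condExp_comap_ae_eq_iff (P := P') hX' hm₁ hm₂ (hint _)
  rw [← hlaw] at key'
  simp only [MeasurableSpace.comap_sup, MeasurableSpace.comap_comp] at key key'
  exact key'.2 (key.1 (hcomp h hh ⟨C, hC⟩ α))

end YWE3
end

section
/- Let (e_k) be an orthonormal basis of U, let W be a U-cylindrical Brownian motion with respect to a filtered probability space (Ω, F, P, (F_t)_{t≥0}), and let (W^k) be continuous versions of (W(1_{(0,·]} ⊗ e_k)) as in the identification. Then for every s ≥ 0, the C([0,∞); ℝ^∞)-valued random variable ω ↦ (t ↦ (W^k(s+t, ω) − W^k(s, ω))_{k∈ℕ}) is independent of F_s. In particular, for all 0 ≤ s < t, the ℝ^∞-valued random variable (W^k(t) − W^k(s))_{k∈ℕ} is independent of F_s. -/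
open MeasureTheory ProbabilityTheory
open scoped NNReal ENNReal

noncomputable section

namespace CylBM4

/-- Lebesgue measure restricted to `[0, ∞)`: the time measure defining `L²([0,∞); U)`. -/
def timeMeasure : Measure ℝ := volume.restrict (Set.Ici (0 : ℝ))

variable {Ω U : Type*}

/-- `W` is a `U`-cylindrical Brownian motion with respect to `(Ω, ℱ, P, (𝓕 t))`:
a bounded linear operator `L²([0,∞); U) → L²(Ω)` such that
(i) each `W f` is a centered Gaussian with `E[(W f)(W g)] = ⟪f, g⟫_{L²}`,
(ii) if `f` is supported in `[0, t]` then `W f` has an `𝓕 t`-measurable representative,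
(iii) if `f` vanishes a.e. on `[0, t]` then `W f` is independent of `𝓕 t`. -/
def IsCylindricalBM [MeasurableSpace Ω]
    [NormedAddCommGroup U] [InnerProductSpace ℝ U]
    (P : Measure Ω) (𝓕 : ℝ → MeasurableSpace Ω)
    (W : Lp U 2 timeMeasure →L[ℝ] Lp ℝ 2 P) : Prop :=
  (∀ f : Lp U 2 timeMeasure, P.map (W f : Ω → ℝ) = gaussianReal 0 (‖f‖₊ ^ 2)) ∧
  (∀ f g : Lp U 2 timeMeasure, ∫ ω, (W f : Ω → ℝ) ω * (W g : Ω → ℝ) ω ∂P = @inner ℝ _ _ f g) ∧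
  (∀ (t : ℝ), 0 ≤ t → ∀ f : Lp U 2 timeMeasure,
    (∀ᵐ s ∂timeMeasure, s ∉ Set.Icc (0:ℝ) t → (f : ℝ → U) s = 0) →
    ∃ g : Ω → ℝ, Measurable[𝓕 t] g ∧ (W f : Ω → ℝ) =ᵐ[P] g) ∧
  (∀ (t : ℝ), 0 ≤ t → ∀ f : Lp U 2 timeMeasure,
    (∀ᵐ s ∂timeMeasure, s ∈ Set.Icc (0:ℝ) t → (f : ℝ → U) s = 0) →
    Indep (MeasurableSpace.comap (W f : Ω → ℝ) inferInstance) (𝓕 t) P)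

/-- `(Wk k)` is a choice of everywhere continuous versions of the processes
`t ↦ W (1_{(0,t]} ⊗ e k)`, identifying the cylindrical Brownian motion `W` with an
`ℝ^∞`-valued process via the orthonormal basis `e`. -/
def IsVersions [MeasurableSpace Ω]
    [NormedAddCommGroup U] [InnerProductSpace ℝ U]
    (P : Measure Ω) (W : Lp U 2 timeMeasure →L[ℝ] Lp ℝ 2 P)
    (e : ℕ → U) (Wk : ℕ → ℝ → Ω → ℝ) : Prop :=
  (∀ (k : ℕ) (ω : Ω), ContinuousOn (fun t => Wk k t ω) (Set.Ici (0:ℝ))) ∧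
  (∀ (k : ℕ) (t : ℝ), 0 ≤ t → ∀ f : Lp U 2 timeMeasure,
    (f : ℝ → U) =ᵐ[timeMeasure] (Set.Ioc (0:ℝ) t).indicator (fun _ => e k) →
    (fun ω => Wk k t ω) =ᵐ[P] (W f : Ω → ℝ))

/-- **Cramér–Wold criterion for independence.** A random vector is independent of `Z` as soon as
all its images under continuous linear functionals are. -/
theorem indepFun_of_forall_strongDual {E F : Type*} [MeasurableSpace Ω]
    [NormedAddCommGroup E] [NormedSpace ℝ E] [CompleteSpace E] [SecondCountableTopology E]
    [MeasurableSpace E] [BorelSpace E] [MeasurableSpace F]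
    {P : Measure Ω} [IsFiniteMeasure P] {X : Ω → E} {Z : Ω → F}
    (hX : Measurable X)
    (h : ∀ L : StrongDual ℝ E, IndepFun (fun ω => L (X ω)) Z P) :
    IndepFun X Z P := by
  rw [indepFun_iff_measure_inter_preimage_eq_mul]
  intro A B hA hB
  have key : (P.restrict (Z ⁻¹' B)).map X = P (Z ⁻¹' B) • P.map X := by
    have : IsFiniteMeasure (P (Z ⁻¹' B) • P.map X) :=
      Measure.smul_finite _ (measure_ne_top _ _)
    refine Measure.ext_of_charFunDual (funext fun L => ?_)
    rw [charFunDual_eq_charFun_map_one, charFunDual_eq_charFun_map_one]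
    congr 1
    rw [Measure.map_smul, Measure.map_map (by fun_prop) hX, Measure.map_map (by fun_prop) hX]
    ext C hC
    have hLX : Measurable (L ∘ X) := L.measurable.comp hX
    rw [Measure.map_apply hLX hC, Measure.restrict_apply (hLX hC), Measure.smul_apply,
      Measure.map_apply hLX hC, smul_eq_mul, mul_comm]
    exact (h L).measure_inter_preimage_eq_mul _ _ hC hB
  have := congrArg (fun μ : Measure E => μ A) key
  simpa [Measure.map_apply hX hA, Measure.restrict_apply (hX hA), mul_comm] using this

/-- A random variable is independent of a σ-algebra if it is independent of all events in it. -/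
theorem indep_comap_of_forall_indepFun {E : Type*} [MeasurableSpace E] {_ : MeasurableSpace Ω}
    {P : Measure Ω} {m : MeasurableSpace Ω} {X : Ω → E}
    (h : ∀ Z : Ω → Prop, Measurable[m] Z → IndepFun X Z P) :
    Indep (MeasurableSpace.comap X inferInstance) m P := by
  rw [Indep_iff]
  rintro _ A ⟨B, hB, rfl⟩ hA
  have := (h (· ∈ A) (measurable_mem.2 hA)).measure_inter_preimage_eq_mul B {True} hB
    (measurableSet_singleton _)
  simpa [Set.preimage] using this

/-- A family of Wiener integrals of functions vanishing on `[0, s]` is independent of `𝓕 s`. -/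
theorem IsCylindricalBM.indepFun_family {ι F : Type*} [mΩ : MeasurableSpace Ω]
    [NormedAddCommGroup U] [InnerProductSpace ℝ U] [MeasurableSpace F]
    {P : Measure Ω} [IsProbabilityMeasure P] {𝓕 : ℝ → MeasurableSpace Ω}
    {W : Lp U 2 timeMeasure →L[ℝ] Lp ℝ 2 P} (hW : IsCylindricalBM P 𝓕 W)
    {s : ℝ} (hs : 0 ≤ s) (h𝓕 : 𝓕 s ≤ mΩ) {f : ι → Lp U 2 timeMeasure}
    (hf : ∀ i, ∀ᵐ r ∂timeMeasure, r ∈ Set.Icc (0 : ℝ) s → (f i : ℝ → U) r = 0)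
    {Z : Ω → F} (hZ : Measurable[𝓕 s] Z) :
    IndepFun (fun ω i => W (f i) ω) Z P := by
  have hmeas (i : ι) : Measurable (W (f i) : Ω → ℝ) := (Lp.stronglyMeasurable _).measurable
  refine IndepFun.process_indepFun hmeas (hZ.mono h𝓕 le_rfl) fun I => ?_
  refine indepFun_of_forall_strongDual (measurable_pi_lambda _ fun i => hmeas i) fun L => ?_
  classical
  let c (i : I) : ℝ := L (Pi.single i 1)
  have hL (x : I → ℝ) : L x = ∑ i, c i * x i := by
    conv_lhs => rw [← Finset.univ_sum_single x]
    rw [map_sum]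
    refine Finset.sum_congr rfl fun i _ => ?_
    rw [mul_comm, ← smul_eq_mul, ← map_smul, ← Pi.single_smul, smul_eq_mul, mul_one]
  let g : Lp U 2 timeMeasure := ∑ i : I, c i • f i
  have hg : ∀ᵐ r ∂timeMeasure, r ∈ Set.Icc (0 : ℝ) s → (g : ℝ → U) r = 0 := by
    have h₁ := Lp.coeFn_finsetSum Finset.univ fun i : I => c i • f i
    have h₂ : ∀ᵐ r ∂timeMeasure, ∀ i : I, (c i • f i : Lp U 2 timeMeasure) r = c i • f i r :=
      ae_all_iff.2 fun i => Lp.coeFn_smul _ _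
    have h₃ : ∀ᵐ r ∂timeMeasure, ∀ i : I, r ∈ Set.Icc (0 : ℝ) s → (f i : ℝ → U) r = 0 :=
      ae_all_iff.2 fun i => hf i
    filter_upwards [h₁, h₂, h₃] with r h₁ h₂ h₃ hr
    rw [h₁, Finset.sum_apply]
    exact Finset.sum_eq_zero fun i _ => by rw [h₂, h₃ i hr, smul_zero]
  have hWg : (W g : Ω → ℝ) =ᵐ[P] fun ω => L fun i : I => W (f i) ω := by
    have h₁ := Lp.coeFn_finsetSum Finset.univ fun i : I => c i • W (f i)
    have h₂ : ∀ᵐ ω ∂P, ∀ i : I, (c i • W (f i) : Lp ℝ 2 P) ω = c i • W (f i) ω :=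
      ae_all_iff.2 fun i => Lp.coeFn_smul _ _
    have h₃ : W g = ∑ i : I, c i • W (f i) := by simp [g]
    filter_upwards [h₁, h₂] with ω h₁ h₂
    rw [h₃, h₁, Finset.sum_apply, hL]
    exact Finset.sum_congr rfl fun i _ => by rw [h₂, smul_eq_mul]
  have hind : IndepFun (W g : Ω → ℝ) Z P :=
    (IndepFun_iff_Indep _ _ _).2 (indep_of_indep_of_le_right (hW.2.2.2 s hs g hg) hZ.comap_le)
  exact hind.congr hWg .rfl

theorem timeMeasure_Ioc_ne_top (a b : ℝ) : timeMeasure (Set.Ioc a b) ≠ ∞ :=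
  ((Measure.restrict_apply_le _ _).trans_lt measure_Ioc_lt_top).ne

/-- The increment of a coordinate process over `(s, t]` is the Wiener integral of
`1_{(s,t]} ⊗ e k`. -/
theorem IsVersions.increment_ae_eq [MeasurableSpace Ω]
    [NormedAddCommGroup U] [InnerProductSpace ℝ U]
    {P : Measure Ω} {W : Lp U 2 timeMeasure →L[ℝ] Lp ℝ 2 P}
    {e : ℕ → U} {Wk : ℕ → ℝ → Ω → ℝ} (hWk : IsVersions P W e Wk)
    (k : ℕ) {s t : ℝ} (hs : 0 ≤ s) (hst : s ≤ t) :
    (W (indicatorConstLp 2 measurableSet_Ioc (timeMeasure_Ioc_ne_top s t) (e k)) : Ω → ℝ)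
      =ᵐ[P] fun ω => Wk k t ω - Wk k s ω := by
  have h : indicatorConstLp 2 measurableSet_Ioc (timeMeasure_Ioc_ne_top s t) (e k) =
      indicatorConstLp 2 measurableSet_Ioc (timeMeasure_Ioc_ne_top 0 t) (e k) -
        indicatorConstLp 2 measurableSet_Ioc (timeMeasure_Ioc_ne_top 0 s) (e k) := by
    rw [eq_sub_iff_add_eq', ← indicatorConstLp_disjoint_union measurableSet_Ioc measurableSet_Ioc
      _ _ (Set.Ioc_disjoint_Ioc_of_le le_rfl)]
    simp only [Set.Ioc_union_Ioc_eq_Ioc hs hst]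
  rw [h, map_sub]
  filter_upwards [Lp.coeFn_sub (W (indicatorConstLp 2 measurableSet_Ioc
      (timeMeasure_Ioc_ne_top 0 t) (e k))) (W (indicatorConstLp 2 measurableSet_Ioc
      (timeMeasure_Ioc_ne_top 0 s) (e k))),
    hWk.2 k t (hs.trans hst) _ indicatorConstLp_coeFn,
    hWk.2 k s hs _ indicatorConstLp_coeFn] with ω h₁ h₂ h₃
  rw [h₁, Pi.sub_apply, h₂, h₃]

/-- **Independence of increments of a cylindrical Brownian motion.**
For every `s ≥ 0` the `C([0,∞); ℝ^∞)`-valued random variable of increments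
`ω ↦ (t ↦ (Wk k (s+t) ω - Wk k s ω)_k)` is independent of `𝓕 s`; in particular every
increment `(Wk k t - Wk k s)_k` with `0 ≤ s < t` is independent of `𝓕 s`.
(The σ-algebra generated by a continuous-path-space valued random variable equals the one
generated by all its point evaluations, which is how it is expressed here.) -/
theorem increments_indep
    [mΩ : MeasurableSpace Ω]
    [NormedAddCommGroup U] [InnerProductSpace ℝ U] [SecondCountableTopology U] [CompleteSpace U]
    (P : Measure Ω) [IsProbabilityMeasure P]
    (𝓕 : ℝ → MeasurableSpace Ω) (h𝓕mono : Monotone 𝓕) (h𝓕le : ∀ t, 𝓕 t ≤ mΩ)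
    (W : Lp U 2 timeMeasure →L[ℝ] Lp ℝ 2 P)
    (hW : IsCylindricalBM P 𝓕 W)
    (e : HilbertBasis ℕ ℝ U)
    (Wk : ℕ → ℝ → Ω → ℝ)
    (hWk : IsVersions P W (fun k => e k) Wk) :
    (∀ s : ℝ, 0 ≤ s →
      Indep
        (MeasurableSpace.comap
          (fun ω => fun t : ℝ≥0 => fun k : ℕ => Wk k (s + (t : ℝ)) ω - Wk k s ω)
          MeasurableSpace.pi)
        (𝓕 s) P) ∧
    (∀ s t : ℝ, 0 ≤ s → s < t →
      Indep
        (MeasurableSpace.comap (fun ω => fun k : ℕ => Wk k t ω - Wk k s ω)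
          MeasurableSpace.pi)
        (𝓕 s) P) := by
  have hprocess (s : ℝ) (hs : 0 ≤ s) (Z : Ω → Prop) (hZ : Measurable[𝓕 s] Z) :
      IndepFun (fun ω (t : ℝ≥0) (k : ℕ) => Wk k (s + (t : ℝ)) ω - Wk k s ω) Z P := by
    let f (p : ℝ≥0 × ℕ) : Lp U 2 timeMeasure :=
      indicatorConstLp 2 measurableSet_Ioc (timeMeasure_Ioc_ne_top s (s + p.1)) (e p.2)
    have hf (p : ℝ≥0 × ℕ) :
        ∀ᵐ r ∂timeMeasure, r ∈ Set.Icc (0 : ℝ) s → (f p : ℝ → U) r = 0 := by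
      filter_upwards [indicatorConstLp_coeFn_notMem (p := 2) (hs := measurableSet_Ioc)
        (hμs := timeMeasure_Ioc_ne_top s (s + p.1)) (c := e p.2)] with r hr hrs
      exact hr fun h => h.1.not_ge hrs.2
    have hind : IndepFun (fun ω (p : ℝ≥0 × ℕ) => Wk p.2 (s + (p.1 : ℝ)) ω - Wk p.2 s ω) Z P :=
      IndepFun.process_congr_left (hW.indepFun_family hs (h𝓕le s) hf hZ)
        fun p => hWk.increment_ae_eq p.2 hs (le_add_of_nonneg_right p.1.coe_nonneg)
    have hcurry : Measurable fun (x : ℝ≥0 × ℕ → ℝ) (t : ℝ≥0) (k : ℕ) => x (t, k) := by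
      fun_prop
    exact hind.comp hcurry measurable_id
  refine ⟨fun s hs => indep_comap_of_forall_indepFun (hprocess s hs), fun s t hs hst =>
    indep_comap_of_forall_indepFun fun Z hZ => ?_⟩
  have hind := (hprocess s hs Z hZ).comp
    (measurable_pi_apply (X := fun _ : ℝ≥0 => ℕ → ℝ) (t - s).toNNReal) measurable_id
  simpa [Function.comp_def, Real.coe_toNNReal _ (sub_nonneg.2 hst.le)] using hind

end CylBM4
end
end

section
/- Let T ∈ (0,∞], Z a separable real Banach space, μ a Borel probability measure on Z, and let u₀ : Ω → Z and W : Ω → C(Ī_T; ℝ^∞) be random variables on (Ω, F, P) with law(u₀, W) = μ ⊗ P^∞_T; set η := (u₀, W). Let 𝔹 be a Polish space with a continuous injection ι : 𝔹 → C(Ī_T; Z), and let u, ũ : Ω → 𝔹 be random variables such that (u, ũ) is jointly compatible with η for the temporal structure, i.e. for every bounded Borel measurable h : Z × C(Ī_T; ℝ^∞) → ℝ and every t ∈ Ī_T, E[h(η) | F_t^u ∨ F_t^ũ ∨ F_t^η] = E[h(η) | F_t^η] P̄-a.s. Then for all s ≤ t in Ī_T, the σ-algebra F_s^u ∨ F_s^ũ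 ∨ F_s^η is independent of the ℝ^∞-valued random variable W(t) − W(s). -/
open MeasureTheory ProbabilityTheory
open scoped NNReal ENNReal

noncomputable section

namespace YWE11

/-- The time interval `Ī_T = [0, T]` for `T ∈ (0, ∞]` (equal to `[0, ∞)` when `T = ∞`). -/
def timeSet (T : ℝ≥0∞) : Set ℝ := {s : ℝ | 0 ≤ s ∧ ENNReal.ofReal s ≤ T}

/-- `β` is a standard real-valued Brownian motion w.r.t. `(Ω, mΩ, P, (𝓕 t))`. -/
def IsStdBM {Ω : Type} (mΩ : MeasurableSpace Ω) (P : @Measure Ω mΩ)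
    (𝓕 : ℝ≥0 → MeasurableSpace Ω) (β : ℝ≥0 → Ω → ℝ) : Prop :=
  (∀ ω, Continuous fun t => β t ω) ∧
  (∀ᵐ ω ∂P, β 0 ω = 0) ∧
  (∀ t, Measurable[𝓕 t] (β t)) ∧
  (∀ s t : ℝ≥0, s ≤ t →
    Indep (MeasurableSpace.comap (fun ω => β t ω - β s ω) inferInstance) (𝓕 s) P) ∧
  (∀ s t : ℝ≥0, s ≤ t → P.map (fun ω => β t ω - β s ω) = gaussianReal 0 (t - s))

/-- `(β k)` is an `ℝ^∞`-Brownian motion w.r.t. `(Ω, mΩ, P, (𝓕 t))`. -/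
def IsRinftyBM {Ω : Type} (mΩ : MeasurableSpace Ω) (P : @Measure Ω mΩ)
    (𝓕 : ℝ≥0 → MeasurableSpace Ω) (β : ℕ → ℝ≥0 → Ω → ℝ) : Prop :=
  (∀ k, IsStdBM mΩ P 𝓕 (β k)) ∧
  iIndep (fun k : ℕ =>
    MeasurableSpace.comap (fun ω => fun t : ℝ≥0 => β k t ω) MeasurableSpace.pi) P

/-- The σ-algebra generated by the measurable `P`-null sets.  (Augmenting a conditioning
σ-algebra by null sets does not change conditional expectations a.e., so this version keeps
the σ-algebras inside the ambient one.) -/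
def mnullSigma {Ω : Type} (mΩ : MeasurableSpace Ω) (P : @Measure Ω mΩ) : MeasurableSpace Ω :=
  MeasurableSpace.generateFrom {N : Set Ω | MeasurableSet[mΩ] N ∧ P N = 0}

/-- The filtration `𝓕ₜ^u` generated by the path of `ι (u ·)` up to time `t` and the null sets. -/
def uFilt {Ω 𝔹 Z : Type} [TopologicalSpace Z] [MeasurableSpace Z] [TopologicalSpace 𝔹]
    {T : ℝ≥0∞} (mΩ : MeasurableSpace Ω) (P : @Measure Ω mΩ)
    (ι : 𝔹 → C(↥(timeSet T), Z)) (u : Ω → 𝔹) (t : ℝ) : MeasurableSpace Ω :=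
  (⨆ (s : ↥(timeSet T)) (_ : (s : ℝ) ≤ t),
      MeasurableSpace.comap (fun ω => ι (u ω) s) inferInstance) ⊔ mnullSigma mΩ P

/-- The filtration `𝓕ₜ^η` generated by `η = (u₀, W)` and the null sets. -/
def etaFilt {Ω Z : Type} [MeasurableSpace Z] (mΩ : MeasurableSpace Ω) (P : @Measure Ω mΩ)
    (T : ℝ≥0∞) (u₀ : Ω → Z) (W : Ω → ℝ → ℕ → ℝ) (t : ℝ) : MeasurableSpace Ω :=
  MeasurableSpace.comap u₀ inferInstance ⊔
    (⨆ (s : ℝ) (_ : s ∈ timeSet T) (_ : s ≤ t),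
      MeasurableSpace.comap (fun ω => fun k : ℕ => W ω s k) MeasurableSpace.pi) ⊔
    mnullSigma mΩ P

/-- If the pairs of σ-algebras `(m₁ i, m₂ i)` are independent across `i` and, for each `i`, `m₁ i`
is independent of `m₂ i`, then the join of all `m₁ i` is independent of the join of all `m₂ i`. -/
lemma indep_iSup_iSup_of_iIndep_sup {Ω ι : Type*} {mΩ : MeasurableSpace Ω} {P : Measure Ω}
    {m₁ m₂ : ι → MeasurableSpace Ω} (h₁ : ∀ i, m₁ i ≤ mΩ) (h₂ : ∀ i, m₂ i ≤ mΩ)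
    (h : iIndep (fun i => m₁ i ⊔ m₂ i) P) (hi : ∀ i, Indep (m₁ i) (m₂ i) P) :
    Indep (⨆ i, m₁ i) (⨆ i, m₂ i) P := by
  have := h.isProbabilityMeasure
  let m : ι → Bool → MeasurableSpace Ω := fun i b => cond b (m₁ i) (m₂ i)
  have hm : ∀ i b, m i b ≤ mΩ := fun i b => by cases b <;> simp [m, h₁, h₂]
  have hfam : iIndepFun (m := fun p : ι × Bool => m p.1 p.2) (fun _ (ω : Ω) => ω) P := by
    refine iIndepFun_uncurry' (m𝓧 := m) (X := fun _ _ ω => ω) (fun i b => measurable_id'' (hm i b))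
      ?_ fun i => ?_
    · have : ∀ i, MeasurableSpace.comap (fun (ω : Ω) (_ : Bool) => ω)
          (@MeasurableSpace.pi _ _ (m i)) = m₁ i ⊔ m₂ i := fun i => by
        simp only [MeasurableSpace.pi, MeasurableSpace.comap_iSup, MeasurableSpace.comap_comp,
          Function.comp_def]
        rw [iSup_bool_eq]
        exact congrArg₂ (· ⊔ ·) MeasurableSpace.comap_id MeasurableSpace.comap_id
      rw [iIndepFun_iff_iIndep]
      simpa only [this] using h
    · rw [iIndepFun_iff_iIndep, iIndep_iff]
      intro s f hf
      have hf' : ∀ b ∈ s, MeasurableSet[m i b] (f b) := fun b hb => by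
        have := hf b hb
        rwa [show MeasurableSpace.comap (fun ω : Ω => ω) (m i b) = m i b from
          MeasurableSpace.comap_id] at this
      clear hf
      have hpair := (Indep_iff _ _ _).1 (hi i) (f true) (f false)
      have hs : s = ∅ ∨ s = {true} ∨ s = {false} ∨ s = {true, false} := by
        clear hf'; decide +revert
      rcases hs with rfl | rfl | rfl | rfl
      · simp
      · simp
      · simp
      · rw [Finset.set_biInter_insert, Finset.set_biInter_singleton]
        simpa using hpair (hf' true (by simp)) (hf' false (by simp))
  have hsup := indep_iSup_of_disjoint (m := fun p : ι × Bool => m p.1 p.2)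
    (fun p => hm p.1 p.2) (by
      have := (iIndepFun_iff_iIndep _ _ _).1 hfam
      simpa only [show ∀ p : ι × Bool, MeasurableSpace.comap (fun ω : Ω => ω) (m p.1 p.2)
        = m p.1 p.2 from fun p => MeasurableSpace.comap_id] using this)
    (S := {p | p.2 = true}) (T := {p | p.2 = false})
    (by rw [Set.disjoint_left]; simp)
  refine indep_of_indep_of_le_left (indep_of_indep_of_le_right hsup ?_) ?_
  · exact iSup_le fun i => le_iSup₂_of_le (i, false) rfl le_rfl
  · exact iSup_le fun i => le_iSup₂_of_le (i, true) rfl le_rfl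

/-- Independence of two functionals of the second coordinate of a product law extends to
independence when the first coordinate is adjoined to one of them. -/
lemma indepFun_prodMk_of_map_eq_prod {Ω Ω' Z E F G : Type*} {mΩ : MeasurableSpace Ω}
    {mΩ' : MeasurableSpace Ω'} [MeasurableSpace Z] [MeasurableSpace E] [MeasurableSpace F]
    [MeasurableSpace G] {P : Measure Ω} {P' : Measure Ω'} [IsProbabilityMeasure P]
    [IsProbabilityMeasure P'] {μ : Measure Z} [IsProbabilityMeasure μ] {X : Ω → Z} {Y : Ω → E}
    {ξ : Ω' → E} (hX : Measurable X) (hY : Measurable Y) (hξ : Measurable ξ)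
    (hlaw : P.map (fun ω => (X ω, Y ω)) = μ.prod (P'.map ξ)) {f : E → F} {g : E → G}
    (hf : Measurable f) (hg : Measurable g)
    (hind : IndepFun (fun ω => f (ξ ω)) (fun ω => g (ξ ω)) P') :
    IndepFun (fun ω => (X ω, f (Y ω))) (fun ω => g (Y ω)) P := by
  have hνp : IsProbabilityMeasure (P'.map ξ) := Measure.isProbabilityMeasure_map hξ.aemeasurable
  have hνf : IsProbabilityMeasure ((P'.map ξ).map f) :=
    Measure.isProbabilityMeasure_map hf.aemeasurable
  have hνg : IsProbabilityMeasure ((P'.map ξ).map g) :=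
    Measure.isProbabilityMeasure_map hg.aemeasurable
  have hfg : (P'.map ξ).map (fun e => (f e, g e)) = ((P'.map ξ).map f).prod ((P'.map ξ).map g) := by
    rw [Measure.map_map (hf.prodMk hg) hξ, Measure.map_map hf hξ, Measure.map_map hg hξ]
    exact (indepFun_iff_map_prod_eq_prod_map_map (hf.comp hξ).aemeasurable
      (hg.comp hξ).aemeasurable).1 hind
  have hYlaw : P.map Y = P'.map ξ := by
    have := congrArg (Measure.map Prod.snd) hlaw
    rw [Measure.map_map measurable_snd (hX.prodMk hY)] at this
    simpa [Function.comp_def] using this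
  have h1 : P.map (fun ω => (X ω, f (Y ω))) = μ.prod ((P'.map ξ).map f) := by
    have := congrArg (Measure.map (Prod.map id f)) hlaw
    rw [Measure.map_map (measurable_id.prodMap hf) (hX.prodMk hY),
      ← Measure.map_prod_map _ _ measurable_id hf, Measure.map_id] at this
    exact this
  have h2 : P.map (fun ω => (X ω, (f (Y ω), g (Y ω)))) =
      μ.prod (((P'.map ξ).map f).prod ((P'.map ξ).map g)) := by
    have := congrArg (Measure.map (Prod.map id (fun e => (f e, g e)))) hlaw
    rw [Measure.map_map (measurable_id.prodMap (hf.prodMk hg)) (hX.prodMk hY),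
      ← Measure.map_prod_map _ _ measurable_id (hf.prodMk hg), Measure.map_id, hfg] at this
    exact this
  refine (indepFun_iff_map_prod_eq_prod_map_map (hX.prodMk (hf.comp hY)).aemeasurable
    (hg.comp hY).aemeasurable).2 ?_
  have h3 : P.map (g ∘ Y) = (P'.map ξ).map g := by
    rw [← hYlaw, Measure.map_map hg hY]
  simp only [Function.comp_apply]
  rw [h1, h3, ← MeasurableEquiv.prodAssoc.map_measurableEquiv_injective.eq_iff,
    Measure.prodAssoc_prod, ← h2]
  exact Measure.map_map (MeasurableEquiv.measurable _)
    ((hX.prodMk (hf.comp hY)).prodMk (hg.comp hY))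

/-- Adjoining null sets to a σ-algebra does not destroy independence. -/
lemma indep_of_le_eventuallyMeasurableSpace {Ω : Type*} {mΩ : MeasurableSpace Ω} {P : Measure Ω}
    {m m₀ m' : MeasurableSpace Ω} (h : Indep m₀ m' P)
    (hle : m ≤ eventuallyMeasurableSpace m₀ (ae P)) : Indep m m' P := by
  rw [Indep_iff] at h ⊢
  intro A B hA hB
  obtain ⟨A₀, hA₀, hAA₀⟩ := hle A hA
  rw [measure_congr hAA₀, measure_congr (hAA₀.inter (ae_eq_refl B)), h A₀ B hA₀ hB]

lemma mnullSigma_le {Ω : Type} {mΩ : MeasurableSpace Ω} {P : Measure Ω} :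
    mnullSigma mΩ P ≤ mΩ :=
  MeasurableSpace.generateFrom_le fun _ hN => hN.1

lemma mnullSigma_le_eventuallyMeasurableSpace {Ω : Type} {mΩ : MeasurableSpace Ω}
    {P : Measure Ω} (m : MeasurableSpace Ω) :
    mnullSigma mΩ P ≤ eventuallyMeasurableSpace m (ae P) :=
  MeasurableSpace.generateFrom_le fun _ hN => ⟨∅, MeasurableSet.empty, ae_eq_empty.2 hN.2⟩

/-- If, for events of `m'`, conditioning on `G` is the same as conditioning on the smaller
σ-algebra `E`, and `E` is independent of `m'`, then so is `G`. -/
lemma indep_of_condExp_indicator_eq {Ω : Type*} {mΩ : MeasurableSpace Ω} {P : Measure Ω}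
    [IsProbabilityMeasure P] {G E m' : MeasurableSpace Ω} (hG : G ≤ mΩ) (hE : E ≤ mΩ)
    (hm' : m' ≤ mΩ) (hind : Indep E m' P)
    (hcond : ∀ B, MeasurableSet[m'] B →
      P[B.indicator (fun _ => (1 : ℝ)) | G] =ᵐ[P] P[B.indicator (fun _ => (1 : ℝ)) | E]) :
    Indep G m' P := by
  rw [Indep_iff]
  intro A B hA hB
  have hint : Integrable (B.indicator fun _ => (1 : ℝ)) P :=
    (integrable_const 1).indicator (hm' B hB)
  have hconst : P[B.indicator (fun _ => (1 : ℝ)) | G] =ᵐ[P] fun _ => P.real B := by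
    refine (hcond B hB).trans ((condExp_indep_eq hm' hE
      (stronglyMeasurable_const.indicator hB) hind.symm).trans (.of_eq ?_))
    simp [integral_indicator_const, hm' B hB]
  have key : P.real (A ∩ B) = P.real A * P.real B := by
    have := setIntegral_condExp hG hint hA
    rw [setIntegral_congr_ae (hG A hA) (hconst.mono fun _ hx _ => hx), setIntegral_const,
      setIntegral_indicator (hm' B hB), setIntegral_const] at this
    simpa using this.symm
  rw [← ENNReal.toReal_eq_toReal_iff' (by finiteness) (by finiteness), ENNReal.toReal_mul]
  exact key

lemma uFilt_le {Ω 𝔹 Z : Type} [TopologicalSpace Z] [MeasurableSpace Z] [BorelSpace Z]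
    [TopologicalSpace 𝔹] [MeasurableSpace 𝔹] [BorelSpace 𝔹] {T : ℝ≥0∞}
    {mΩ : MeasurableSpace Ω} {P : Measure Ω} {ι : 𝔹 → C(↥(timeSet T), Z)} (hι : Continuous ι)
    {u : Ω → 𝔹} (hu : Measurable u) (t : ℝ) : uFilt mΩ P ι u t ≤ mΩ :=
  sup_le (iSup₂_le fun s _ =>
    (((continuous_eval_const (F := C(↥(timeSet T), Z)) s).comp hι).measurable.comp hu).comap_le) mnullSigma_le

lemma etaFilt_le {Ω Z : Type} [MeasurableSpace Z] {mΩ : MeasurableSpace Ω} {P : Measure Ω}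
    {T : ℝ≥0∞} {u₀ : Ω → Z} {W : Ω → ℝ → ℕ → ℝ} (hu₀ : Measurable u₀)
    (hW : ∀ s ∈ timeSet T, ∀ k : ℕ, Measurable fun ω => W ω s k) (t : ℝ) :
    etaFilt mΩ P T u₀ W t ≤ mΩ :=
  sup_le (sup_le hu₀.comap_le (iSup_le fun s => iSup₂_le fun hs _ =>
    (measurable_pi_lambda _ (hW s hs)).comap_le)) mnullSigma_le

/-- Up to null sets, `etaFilt` is generated by the initial value and the stopped noise path. -/
lemma etaFilt_le_eventuallyMeasurableSpace {Ω Z : Type} [MeasurableSpace Z]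
    {mΩ : MeasurableSpace Ω} {P : Measure Ω} {T : ℝ≥0∞} (u₀ : Ω → Z) (W : Ω → ℝ → ℕ → ℝ)
    (t : ℝ) :
    etaFilt mΩ P T u₀ W t ≤ eventuallyMeasurableSpace
      (MeasurableSpace.comap (fun ω => (u₀ ω,
        fun (r : {p : timeSet T // (p : ℝ) ≤ t}) (k : ℕ) => W ω r.1 k)) inferInstance)
      (ae P) := by
  refine sup_le (le_trans ?_ fun _ h => h.eventuallyMeasurableSet)
    (mnullSigma_le_eventuallyMeasurableSpace _)
  refine sup_le ?_ (iSup_le fun r => iSup₂_le fun hr hrt => ?_)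
  · rintro _ ⟨B, hB, rfl⟩
    exact ⟨Prod.fst ⁻¹' B, measurable_fst hB, rfl⟩
  · rintro _ ⟨B, hB, rfl⟩
    exact ⟨(fun x : Z × ({p : timeSet T // (p : ℝ) ≤ t} → ℕ → ℝ) => x.2 ⟨⟨r, hr⟩, hrt⟩) ⁻¹' B,
      (by fun_prop : Measurable fun x : Z × ({p : timeSet T // (p : ℝ) ≤ t} → ℕ → ℝ) =>
        x.2 ⟨⟨r, hr⟩, hrt⟩) hB, rfl⟩

/-- The increments of an `ℝ^∞`-Brownian motion are independent of its past. -/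
lemma IsRinftyBM.indepFun_past_increment {Ω : Type} {mΩ : MeasurableSpace Ω} {P : Measure Ω}
    {𝓕 : ℝ≥0 → MeasurableSpace Ω} {β : ℕ → ℝ≥0 → Ω → ℝ} (hβ : IsRinftyBM mΩ P 𝓕 β)
    (h𝓕 : ∀ t, 𝓕 t ≤ mΩ) (hmono : Monotone 𝓕) {s t : ℝ≥0} (hst : s ≤ t)
    {ι : Type*} {τ : ι → ℝ≥0} (hτ : ∀ i, τ i ≤ s) :
    IndepFun (fun ω i k => β k (τ i) ω) (fun ω k => β k t ω - β k s ω) P := by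
  have hmeas : ∀ k r, Measurable (β k r) := fun k r => ((hβ.1 k).2.2.1 r).mono (h𝓕 r) le_rfl
  let m₁ : ℕ → MeasurableSpace Ω := fun k =>
    MeasurableSpace.comap (fun ω i => β k (τ i) ω) MeasurableSpace.pi
  let m₂ : ℕ → MeasurableSpace Ω := fun k =>
    MeasurableSpace.comap (fun ω => β k t ω - β k s ω) inferInstance
  have hsup : Indep (⨆ k, m₁ k) (⨆ k, m₂ k) P := by
    refine indep_iSup_iSup_of_iIndep_sup
      (fun k => (measurable_pi_lambda _ fun i => hmeas k (τ i)).comap_le)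
      (fun k => ((hmeas k t).sub (hmeas k s)).comap_le) ?_ fun k => ?_
    · refine iIndep_of_iIndep_of_le hβ.2 fun k => sup_le ?_ ?_
      · rintro _ ⟨B, hB, rfl⟩
        exact ⟨(fun x i => x (τ i)) ⁻¹' B,
          (by fun_prop : Measurable fun (x : ℝ≥0 → ℝ) i => x (τ i)) hB, rfl⟩
      · rintro _ ⟨B, hB, rfl⟩
        exact ⟨(fun x => x t - x s) ⁻¹' B,
          (by fun_prop : Measurable fun x : ℝ≥0 → ℝ => x t - x s) hB, rfl⟩
    · refine indep_of_indep_of_le_left ((hβ.1 k).2.2.2.1 s t hst).symm ?_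
      refine (MeasurableSpace.comap_process_pi fun i ω => β k (τ i) ω).trans_le ?_
      exact iSup_le fun i => (((hβ.1 k).2.2.1 (τ i)).mono (hmono (hτ i)) le_rfl).comap_le
  rw [IndepFun_iff_Indep]
  refine indep_of_indep_of_le_left (indep_of_indep_of_le_right hsup ?_) ?_
  · rw [MeasurableSpace.comap_process_pi (fun k ω => β k t ω - β k s ω)]
  · rw [MeasurableSpace.comap_process_pi (fun i ω k => β k (τ i) ω)]
    refine iSup_le fun i => ?_
    rw [MeasurableSpace.comap_process_pi (fun k ω => β k (τ i) ω)]
    exact iSup_mono fun k => MeasurableSpace.comap_le_comap_pi (g := fun i ω => β k (τ i) ω) i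

/-- **Joint temporal compatibility forces independence of the increments of the noise from the
past of the solutions** (Lemma on jointly compatible pairs): if `law (u₀, W) = μ ⊗ P^∞_T` and
`(u, v)` is jointly compatible with `η = (u₀, W)` for the temporal compatibility structure,
then for all `s ≤ t` in `Ī_T` the σ-algebra `𝓕ₛ^u ∨ 𝓕ₛ^v ∨ 𝓕ₛ^η` is independent of the
increment `W (t) - W (s)`. -/
theorem indep_of_jointly_compatible
    {Z : Type} [NormedAddCommGroup Z] [NormedSpace ℝ Z] [SecondCountableTopology Z]
    [CompleteSpace Z] [MeasurableSpace Z] [BorelSpace Z]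
    {𝔹 : Type} [TopologicalSpace 𝔹] [PolishSpace 𝔹] [MeasurableSpace 𝔹] [BorelSpace 𝔹]
    (T : ℝ≥0∞) (hT : 0 < T)
    (ι : 𝔹 → C(↥(timeSet T), Z)) (hι : Continuous ι) (hιinj : Function.Injective ι)
    {Ω : Type} [mΩ : MeasurableSpace Ω] (P : Measure Ω) [IsProbabilityMeasure P]
    (μZ : Measure Z) [IsProbabilityMeasure μZ]
    (u₀ : Ω → Z) (W : Ω → ℝ → ℕ → ℝ)
    (hu₀ : Measurable u₀)
    (hWmeas : ∀ s ∈ timeSet T, ∀ k : ℕ, Measurable fun ω => W ω s k)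
    (hWcont : ∀ ω, ContinuousOn (fun s => W ω s) (timeSet T))
    (hlaw : ∃ (Ω' : Type) (mΩ' : MeasurableSpace Ω') (P' : @Measure Ω' mΩ')
        (𝓕' : ℝ≥0 → MeasurableSpace Ω') (β : ℕ → ℝ≥0 → Ω' → ℝ),
      (∀ t, 𝓕' t ≤ mΩ') ∧ Monotone 𝓕' ∧ IsProbabilityMeasure P' ∧
      IsRinftyBM mΩ' P' 𝓕' β ∧
      P.map (fun ω => (u₀ ω, fun p : ↥(timeSet T) => fun k : ℕ => W ω ↑p k)) =
        μZ.prod (P'.map (fun ω' => fun p : ↥(timeSet T) => fun k : ℕ => β k ⟨↑p, p.2.1⟩ ω')))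
    (u v : Ω → 𝔹) (hu : Measurable u) (hv : Measurable v)
    (hcomp : ∀ h : Z × (↥(timeSet T) → ℕ → ℝ) → ℝ,
      Measurable h → (∃ C : ℝ, ∀ x, |h x| ≤ C) → ∀ t ∈ timeSet T,
        P[(fun ω => h (u₀ ω, fun p : ↥(timeSet T) => fun k : ℕ => W ω ↑p k)) |
            uFilt mΩ P ι u t ⊔ uFilt mΩ P ι v t ⊔ etaFilt mΩ P T u₀ W t]
          =ᵐ[P]
        P[(fun ω => h (u₀ ω, fun p : ↥(timeSet T) => fun k : ℕ => W ω ↑p k)) |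
            etaFilt mΩ P T u₀ W t]) :
    ∀ s t : ℝ, s ∈ timeSet T → t ∈ timeSet T → s ≤ t →
      Indep (uFilt mΩ P ι u s ⊔ uFilt mΩ P ι v s ⊔ etaFilt mΩ P T u₀ W s)
        (MeasurableSpace.comap (fun ω => fun k : ℕ => W ω t k - W ω s k)
          MeasurableSpace.pi) P := by
  intro s t hs ht hst
  obtain ⟨Ω', mΩ', P', 𝓕', β, h𝓕, hmono, hP', hβ, hmap⟩ := hlaw
  let Y : Ω → timeSet T → ℕ → ℝ := fun ω p k => W ω p k
  let past : (timeSet T → ℕ → ℝ) → {p : timeSet T // (p : ℝ) ≤ s} → ℕ → ℝ := fun w r => w r.1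
  let incr : (timeSet T → ℕ → ℝ) → ℕ → ℝ := fun w k => w ⟨t, ht⟩ k - w ⟨s, hs⟩ k
  have hpast : Measurable past := by fun_prop
  have hincr : Measurable incr := by fun_prop
  have hY : Measurable Y :=
    measurable_pi_lambda _ fun p => measurable_pi_lambda _ fun k => hWmeas p p.2 k
  have hindη : IndepFun (fun ω => (u₀ ω, past (Y ω))) (fun ω => incr (Y ω)) P := by
    refine indepFun_prodMk_of_map_eq_prod hu₀ hY ?_ hmap hpast hincr ?_
    · exact measurable_pi_lambda _ fun p => measurable_pi_lambda _ fun k =>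
        ((hβ.1 k).2.2.1 _).mono (h𝓕 _) le_rfl
    · exact hβ.indepFun_past_increment h𝓕 hmono (s := ⟨s, hs.1⟩) (t := ⟨t, ht.1⟩) hst
        (τ := fun r : {p : timeSet T // (p : ℝ) ≤ s} => ⟨r.1, r.1.2.1⟩) fun r => r.2
  have hindE : Indep (etaFilt mΩ P T u₀ W s)
      (MeasurableSpace.comap (fun ω => incr (Y ω)) MeasurableSpace.pi) P :=
    indep_of_le_eventuallyMeasurableSpace ((IndepFun_iff_Indep _ _ _).1 hindη)
      (etaFilt_le_eventuallyMeasurableSpace u₀ W s)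
  refine indep_of_condExp_indicator_eq
    (sup_le (sup_le (uFilt_le hι hu s) (uFilt_le hι hv s)) (etaFilt_le hu₀ hWmeas s))
    (etaFilt_le hu₀ hWmeas s) (hincr.comp hY).comap_le hindE ?_
  rintro _ ⟨B, hB, rfl⟩
  refine hcomp (fun x => (incr ⁻¹' B).indicator (fun _ => (1 : ℝ)) x.2)
    ((measurable_const.indicator (hincr hB)).comp measurable_snd) ⟨1, fun x => ?_⟩ s hs
  by_cases hx : x.2 ∈ incr ⁻¹' B <;> simp [hx]

end YWE11
end
end

section
/- Let T ∈ (0,∞], let Z be a separable real Banach space, let 𝔹 be a Polish space with a continuous injection ι : 𝔹 → C(Ī_T; Z), and let (Ω, F, P, (F_t)_{t∈Ī_T}) be a filtered probability space. Let u : Ī_T × Ω → Z be jointly measurable and (F_t)-adapted with u(·, ω) ∈ ι(𝔹) for every ω ∈ Ω, and let W be a U-cylindrical Brownian motion with respect to (Ω, F, P, (F_t)), with continuous versions (W^k) as in the identification, restricted to Ī_T. Then u is compatible with η := (u(0,·), (W^k)) for the temporal structure: for every bounded Borel measurable h : Z × C(Ī_T; ℝ^∞) → ℝ and every t ∈ Ī_T,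 E[h(η) | F_t^u ∨ F_t^η] = E[h(η) | F_t^η] P̄-a.s., where F_t^u := σ({u(s,·) : s ∈ [0,t] ∩ Ī_T} ∪ N) and F_t^η := σ({u(0,·)} ∪ {W^k(s) : k ∈ ℕ, s ∈ [0,t] ∩ Ī_T} ∪ N), N being the collection of all P-null sets. -/
open MeasureTheory ProbabilityTheory
open scoped NNReal ENNReal

noncomputable section

namespace YWE12

/-- Lebesgue measure restricted to `[0, ∞)`: the time measure defining `L²([0,∞); U)`. -/
def timeMeasure : Measure ℝ := volume.restrict (Set.Ici (0 : ℝ))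

/-- The time interval `Ī_T = [0, T]` for `T ∈ (0, ∞]` (equal to `[0, ∞)` when `T = ∞`). -/
def timeSet (T : ℝ≥0∞) : Set ℝ := {s : ℝ | 0 ≤ s ∧ ENNReal.ofReal s ≤ T}

/-- The time `0` as an element of `Ī_T`. -/
def timeZero (T : ℝ≥0∞) : ↥(timeSet T) := ⟨0, ⟨le_rfl, by simp⟩⟩

variable {Ω U : Type*}

/-- The σ-algebra generated by the measurable `P`-null sets. -/
def mnullSigma [mΩ : MeasurableSpace Ω] (P : Measure Ω) : MeasurableSpace Ω :=
  MeasurableSpace.generateFrom {N : Set Ω | MeasurableSet[mΩ] N ∧ P N = 0}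

/-- `W` is a `U`-cylindrical Brownian motion with respect to `(Ω, ℱ, P, (𝓕 t))`. -/
def IsCylindricalBM [MeasurableSpace Ω]
    [NormedAddCommGroup U] [InnerProductSpace ℝ U]
    (P : Measure Ω) (𝓕 : ℝ → MeasurableSpace Ω)
    (W : Lp U 2 timeMeasure →L[ℝ] Lp ℝ 2 P) : Prop :=
  (∀ f : Lp U 2 timeMeasure, P.map (W f : Ω → ℝ) = gaussianReal 0 (‖f‖₊ ^ 2)) ∧
  (∀ f g : Lp U 2 timeMeasure, ∫ ω, (W f : Ω → ℝ) ω * (W g : Ω → ℝ) ω ∂P = @inner ℝ _ _ f g) ∧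
  (∀ (t : ℝ), 0 ≤ t → ∀ f : Lp U 2 timeMeasure,
    (∀ᵐ s ∂timeMeasure, s ∉ Set.Icc (0:ℝ) t → (f : ℝ → U) s = 0) →
    ∃ g : Ω → ℝ, Measurable[𝓕 t] g ∧ (W f : Ω → ℝ) =ᵐ[P] g) ∧
  (∀ (t : ℝ), 0 ≤ t → ∀ f : Lp U 2 timeMeasure,
    (∀ᵐ s ∂timeMeasure, s ∈ Set.Icc (0:ℝ) t → (f : ℝ → U) s = 0) →
    Indep (MeasurableSpace.comap (W f : Ω → ℝ) inferInstance) (𝓕 t) P)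

/-- `(Wk k)` are continuous versions of `t ↦ W (1_{(0,t]} ⊗ e k)`. -/
def IsVersions [MeasurableSpace Ω]
    [NormedAddCommGroup U] [InnerProductSpace ℝ U]
    (P : Measure Ω) (W : Lp U 2 timeMeasure →L[ℝ] Lp ℝ 2 P)
    (e : ℕ → U) (Wk : ℕ → ℝ → Ω → ℝ) : Prop :=
  (∀ (k : ℕ) (ω : Ω), ContinuousOn (fun t => Wk k t ω) (Set.Ici (0:ℝ))) ∧
  (∀ (k : ℕ) (t : ℝ), 0 ≤ t → ∀ f : Lp U 2 timeMeasure,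
    (f : ℝ → U) =ᵐ[timeMeasure] (Set.Ioc (0:ℝ) t).indicator (fun _ => e k) →
    (fun ω => Wk k t ω) =ᵐ[P] (W f : Ω → ℝ))

/-- If every real linear functional of a finite-dimensional vector `Y` has, on the event `A`, the
law `P A • law`, then so does `Y` (Cramér-Wold). -/
theorem measure_inter_preimage_eq_mul_of_dual {ι : Type*} [Fintype ι] [MeasurableSpace Ω]
    {P : Measure Ω} [IsProbabilityMeasure P] {A : Set Ω} {Y : Ω → ι → ℝ}
    (hY : AEMeasurable Y P)
    (hdual : ∀ L : StrongDual ℝ (ι → ℝ),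
      (P.restrict A).map (fun ω => L (Y ω)) = P A • P.map (fun ω => L (Y ω)))
    {B : Set (ι → ℝ)} (hB : MeasurableSet B) :
    P (A ∩ Y ⁻¹' B) = P A * P (Y ⁻¹' B) := by
  have hYA : AEMeasurable Y (P.restrict A) := hY.restrict
  have hfin : IsFiniteMeasure (P A • P.map Y) :=
    Measure.smul_finite _ (measure_ne_top P A)
  have key : (P.restrict A).map Y = P A • P.map Y := by
    refine Measure.ext_of_charFunDual (funext fun L => ?_)
    have hL : Measurable L := L.continuous.measurable
    rw [charFunDual_eq_charFun_map_one, charFunDual_eq_charFun_map_one, Measure.map_smul,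
      AEMeasurable.map_map_of_aemeasurable hL.aemeasurable hYA,
      AEMeasurable.map_map_of_aemeasurable hL.aemeasurable hY]
    exact congrArg (fun μ => charFun μ 1) (hdual L)
  have h := congrArg (fun μ => μ B) key
  simp only [Measure.smul_apply, smul_eq_mul] at h
  rw [Measure.map_apply_of_aemeasurable hYA hB, Measure.map_apply_of_aemeasurable hY hB,
    Measure.restrict_apply₀ (hYA.nullMeasurableSet_preimage hB), Set.inter_comm] at h
  exact h

/-- A family of versions of `W f`, with `f` vanishing on `[0, t]`, is jointly independent of any
random variable measurable with respect to `𝓕 t`. -/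
theorem IsCylindricalBM.indepFun_process {S E : Type*} {mE : MeasurableSpace E}
    [NormedAddCommGroup U] [InnerProductSpace ℝ U]
    [mΩ : MeasurableSpace Ω] {P : Measure Ω} [IsProbabilityMeasure P]
    {𝓕 : ℝ → MeasurableSpace Ω} (h𝓕le : ∀ t, 𝓕 t ≤ mΩ)
    {W : Lp U 2 timeMeasure →L[ℝ] Lp ℝ 2 P} (hW : IsCylindricalBM P 𝓕 W)
    {t : ℝ} (ht : 0 ≤ t) {f : S → Lp U 2 timeMeasure}
    (hf : ∀ i, ∀ᵐ s ∂timeMeasure, s ∈ Set.Icc (0 : ℝ) t → (f i : ℝ → U) s = 0)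
    {Y : S → Ω → ℝ} (hY : ∀ i, Y i =ᵐ[P] (W (f i) : Ω → ℝ))
    {X : Ω → E} (hX : Measurable[𝓕 t] X) :
    IndepFun X (fun ω i => Y i ω) P := by
  have hYm : ∀ i, AEMeasurable (Y i) P := fun i =>
    (Lp.stronglyMeasurable (W (f i))).measurable.aemeasurable.congr (hY i).symm
  refine IndepFun.indepFun_process₀ (hX.mono (h𝓕le t) le_rfl).aemeasurable hYm fun I => ?_
  rw [indepFun_iff_measure_inter_preimage_eq_mul]
  intro s B hs hB
  refine measure_inter_preimage_eq_mul_of_dual (Y := fun ω (i : I) => Y i ω) (aemeasurable_pi_lambda _ fun i => hYm i)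
    (fun L => ?_) hB
  classical
  set c : I → ℝ := fun i => L (Pi.single i 1)
  set g : Lp U 2 timeMeasure := ∑ i : I, c i • f i
  have hg : ∀ᵐ s ∂timeMeasure, s ∈ Set.Icc (0 : ℝ) t → (g : ℝ → U) s = 0 := by
    have h1 : ∀ᵐ s ∂timeMeasure, ∀ i : I, (c i • f i : Lp U 2 timeMeasure) s = c i • f i s :=
      ae_all_iff.2 fun i => Lp.coeFn_smul (c i) (f i)
    filter_upwards [Lp.coeFn_fun_finsetSum Finset.univ fun i : I => c i • f i, h1,
      ae_all_iff.2 fun i : I => hf i] with s h2 h1 h3 hs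
    rw [h2]
    exact Finset.sum_eq_zero fun i _ => by rw [h1, h3 i hs, smul_zero]
  have hLY : (fun ω => L fun i : I => Y i ω) =ᵐ[P] (W g : Ω → ℝ) := by
    have hWg : W g = ∑ i : I, c i • W (f i) := by simp [g, map_sum]
    have h1 : ∀ᵐ ω ∂P, ∀ i : I, (c i • W (f i) : Lp ℝ 2 P) ω = c i • W (f i) ω :=
      ae_all_iff.2 fun i => Lp.coeFn_smul (c i) (W (f i))
    rw [hWg]
    filter_upwards [Lp.coeFn_fun_finsetSum Finset.univ fun i : I => c i • W (f i), h1,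
      ae_all_iff.2 fun i : I => hY i] with ω h2 h1 h3
    rw [h2, ← ContinuousLinearMap.coe_coe, LinearMap.pi_apply_eq_sum_univ]
    refine Finset.sum_congr rfl fun i _ => ?_
    rw [h1, ← h3 i, smul_eq_mul, smul_eq_mul, mul_comm]
    have hi : (fun j => if i = j then (1 : ℝ) else 0) = Pi.single i 1 := by
      ext j
      simp [Pi.single_apply, eq_comm]
    rw [hi]
    rfl
  have hWgm : Measurable (W g : Ω → ℝ) := (Lp.stronglyMeasurable (W g)).measurable
  rw [Measure.map_congr (ae_restrict_of_ae hLY), Measure.map_congr hLY]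
  ext C hC
  rw [Measure.map_apply hWgm hC, Measure.restrict_apply (hWgm hC), Measure.smul_apply,
    Measure.map_apply hWgm hC, smul_eq_mul, mul_comm]
  exact (Indep_iff _ _ _).1 (hW.2.2.2 t ht g hg) _ _ ⟨C, hC, rfl⟩ (hX hs)

/-- Enlarging a σ-algebra by measurable null sets preserves independence. -/
theorem Indep.eventuallyMeasurableSpace_inf {m₁ m₂ : MeasurableSpace Ω} [mΩ : MeasurableSpace Ω]
    {P : Measure Ω} (h : Indep m₁ m₂ P) :
    Indep (eventuallyMeasurableSpace m₁ (ae P) ⊓ mΩ) m₂ P := by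
  rw [Indep_iff] at h ⊢
  rintro A B hA hB
  obtain ⟨A', hA', hAA'⟩ := (MeasurableSpace.measurableSet_inf.1 hA).1
  rw [measure_congr hAA', measure_congr (hAA'.inter (ae_eq_refl B)), h A' B hA' hB]

/-- Countably many processes with continuous paths and a.e.-measurable marginals have
a modification with measurable marginals, up to indistinguishability. -/
theorem exists_measurable_indistinguishable {κ : Type*} [Countable κ] [MeasurableSpace Ω]
    {P : Measure Ω} {X : κ → ℝ → Ω → ℝ}
    (hc : ∀ k ω, ContinuousOn (fun t => X k t ω) (Set.Ici 0))
    (hm : ∀ k t, 0 ≤ t → AEMeasurable (X k t) P) :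
    ∃ V : κ → ℝ → Ω → ℝ, (∀ k t, Measurable (V k t)) ∧
      ∀ᵐ ω ∂P, ∀ k t, 0 ≤ t → X k t ω = V k t ω := by
  have hm' : ∀ k t, AEMeasurable (X k (max t 0)) P := fun k t => hm k _ (le_max_right _ _)
  have hc' : ∀ k ω, Continuous fun t => X k (max t 0) ω := fun k ω =>
    (hc k ω).comp_continuous (by fun_prop) fun t => le_max_right t 0
  have hae : ∀ᵐ ω ∂P, ∀ (k : κ) (q : ℚ), X k (max q 0) ω = (hm' k q).mk _ ω :=
    ae_all_iff.2 fun k => ae_all_iff.2 fun q => (hm' k q).ae_eq_mk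
  obtain ⟨N, hN, hNm, hNP⟩ := exists_measurable_superset_of_null (ae_iff.1 hae)
  have hNX : ∀ ω ∉ N, ∀ (k : κ) (q : ℚ), X k (max q 0) ω = (hm' k q).mk _ ω := fun ω hω => by
    by_contra hne
    exact hω (hN hne)
  refine ⟨fun k t => Nᶜ.indicator (X k (max t 0)), fun k t => ?_, ?_⟩
  · obtain ⟨q, -, hq⟩ := Real.exists_seq_rat_strictMono_tendsto t
    refine measurable_of_tendsto_metrizable (f := fun n => Nᶜ.indicator (X k (max (q n) 0)))
      (fun n => ?_) (tendsto_pi_nhds.2 fun ω => ?_)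
    · have : Nᶜ.indicator (X k (max (q n) 0)) = Nᶜ.indicator ((hm' k (q n)).mk _) :=
        Set.indicator_congr fun ω hω => hNX ω hω k (q n)
      rw [this]
      exact (hm' k (q n)).measurable_mk.indicator hNm.compl
    · by_cases hω : ω ∈ N
      · simp [hω]
      · simpa [hω, Function.comp_def] using ((hc' k ω).tendsto t).comp hq.2
  · filter_upwards [compl_mem_ae_iff.2 hNP] with ω hω k t ht
    rw [Set.indicator_of_mem hω, max_eq_left ht]

/-- Conditioning a function of `(X, Y)`, with `Y` independent of `H` and `X` measurable with
respect to `G ≤ H`, on `H` or on `G` gives the same result. -/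
theorem condExp_ae_eq_condExp_of_indep {E F : Type*} [MeasurableSpace E] [MeasurableSpace F]
    {G H : MeasurableSpace Ω} [mΩ : MeasurableSpace Ω] {P : Measure Ω} [IsProbabilityMeasure P]
    (hGH : G ≤ H) (hH : H ≤ mΩ) {X : Ω → E} (hX : Measurable[G] X) {Y : Ω → F}
    (hY : AEMeasurable Y P) (hind : Indep H (MeasurableSpace.comap Y inferInstance) P)
    {φ : E × F → ℝ} (hφ : Measurable φ) {C : ℝ} (hC : ∀ x, |φ x| ≤ C) :
    P[fun ω => φ (X ω, Y ω) | H] =ᵐ[P] P[fun ω => φ (X ω, Y ω) | G] := by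
  have hXm : Measurable X := hX.mono (hGH.trans hH) le_rfl
  have hYprob : IsProbabilityMeasure (P.map Y) := Measure.isProbabilityMeasure_map hY
  have hint : Integrable (fun ω => φ (X ω, Y ω)) P :=
    Integrable.of_bound (hφ.comp_aemeasurable (hXm.aemeasurable.prodMk hY)).aestronglyMeasurable C
      (ae_of_all _ fun ω => hC _)
  set g : E → ℝ := fun x => ∫ y, φ (x, y) ∂P.map Y with hg
  have hgm : StronglyMeasurable g := hφ.stronglyMeasurable.integral_prod_right'
  have hgC : ∀ x, ‖g x‖ ≤ C := fun x => by
    simpa using norm_integral_le_of_norm_le_const (μ := P.map Y) (f := fun y => φ (x, y)) (C := C)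
      (ae_of_all _ fun y => hC (x, y))
  have hgint : Integrable (fun ω => g (X ω)) P :=
    Integrable.of_bound (hgm.comp_measurable hXm).aestronglyMeasurable C
      (ae_of_all _ fun ω => hgC _)
  have key : ∀ A, MeasurableSet[H] A → ∫ ω in A, g (X ω) ∂P = ∫ ω in A, φ (X ω, Y ω) ∂P := by
    intro A hA
    have hAm : MeasurableSet A := hH A hA
    set X' : Ω → ℝ × E := fun ω => (A.indicator 1 ω, X ω) with hX'
    have hX'H : Measurable[H] X' :=
      (Measurable.indicator (m := H) measurable_const hA).prodMk (hX.mono hGH le_rfl)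
    have hX'm : Measurable X' := hX'H.mono hH le_rfl
    have hprob : IsProbabilityMeasure (P.map X') :=
      Measure.isProbabilityMeasure_map hX'm.aemeasurable
    have hindep : IndepFun X' Y P := indep_of_indep_of_le_left hind hX'H.comap_le
    have hlaw := hindep.map_prod_eq_prod_map_map hX'm.aemeasurable hY
    have hψ : Measurable fun z : (ℝ × E) × F => z.1.1 * φ (z.1.2, z.2) := by fun_prop
    have hXY : AEMeasurable (fun ω => (X' ω, Y ω)) P := hX'm.aemeasurable.prodMk hY
    have hψint : Integrable (fun z : (ℝ × E) × F => z.1.1 * φ (z.1.2, z.2))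
        ((P.map X').prod (P.map Y)) := by
      rw [← hlaw, integrable_map_measure hψ.aestronglyMeasurable hXY]
      refine (hint.indicator hAm).congr (ae_of_all _ fun ω => ?_)
      by_cases hω : ω ∈ A <;> simp [hX', hω]
    have hgm' : AEStronglyMeasurable (fun x : ℝ × E => x.1 * g x.2) (P.map X') :=
      (measurable_fst.mul (hgm.measurable.comp measurable_snd)).aestronglyMeasurable
    calc ∫ ω in A, g (X ω) ∂P = ∫ ω, (X' ω).1 * g (X' ω).2 ∂P := by
          rw [← integral_indicator hAm]
          congr 1 with ω
          by_cases hω : ω ∈ A <;> simp [hX', hω]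
      _ = ∫ x, x.1 * g x.2 ∂P.map X' := (integral_map hX'm.aemeasurable hgm').symm
      _ = ∫ z, z.1.1 * φ (z.1.2, z.2) ∂(P.map X').prod (P.map Y) := by
          rw [integral_prod _ hψint]
          simp only [hg, integral_const_mul]
      _ = ∫ ω, (X' ω).1 * φ ((X' ω).2, Y ω) ∂P := by
          rw [← hlaw, integral_map hXY hψ.aestronglyMeasurable]
      _ = ∫ ω in A, φ (X ω, Y ω) ∂P := by
          rw [← integral_indicator hAm]
          congr 1 with ω
          by_cases hω : ω ∈ A <;> simp [hX', hω]
  have hgG : StronglyMeasurable[G] fun ω => g (X ω) := hgm.comp_measurable hX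
  have hcond : ∀ m : MeasurableSpace Ω, G ≤ m → m ≤ H →
      (fun ω => g (X ω)) =ᵐ[P] P[fun ω => φ (X ω, Y ω) | m] := fun m hGm hmH =>
    ae_eq_condExp_of_forall_setIntegral_eq (hmH.trans hH) hint
      (fun _ _ _ => hgint.integrableOn) (fun A hA _ => key A (hmH A hA))
      (hgG.mono hGm).aestronglyMeasurable
  exact (hcond H hGH le_rfl).symm.trans (hcond G le_rfl hGH)

/-- In the situation of `condExp_ae_eq_condExp_of_indep`, conditioning on a σ-algebra between `G`
and `H` gives the same result too. -/
theorem condExp_sup_ae_eq_condExp_of_indep {E F : Type*} [MeasurableSpace E] [MeasurableSpace F]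
    {M G H : MeasurableSpace Ω} [mΩ : MeasurableSpace Ω] {P : Measure Ω} [IsProbabilityMeasure P]
    (hMH : M ≤ H) (hGH : G ≤ mΩ → G ≤ H) (hH : H ≤ mΩ) {X : Ω → E} (hX : Measurable[G] X)
    {Y : Ω → F} (hY : AEMeasurable Y P)
    (hind : Indep H (MeasurableSpace.comap Y inferInstance) P)
    {φ : E × F → ℝ} (hφ : Measurable φ) {C : ℝ} (hC : ∀ x, |φ x| ≤ C) :
    P[fun ω => φ (X ω, Y ω) | M ⊔ G] =ᵐ[P] P[fun ω => φ (X ω, Y ω) | G] := by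
  by_cases hG : G ≤ mΩ
  swap
  · rw [condExp_of_not_le hG, condExp_of_not_le fun hle => hG (le_sup_right.trans hle)]
  have hm : M ⊔ G ≤ H := sup_le hMH (hGH hG)
  calc P[fun ω => φ (X ω, Y ω) | M ⊔ G]
      =ᵐ[P] P[P[fun ω => φ (X ω, Y ω) | H] | M ⊔ G] := (condExp_condExp_of_le hm hH).symm
    _ =ᵐ[P] P[P[fun ω => φ (X ω, Y ω) | G] | M ⊔ G] :=
        condExp_congr_ae (condExp_ae_eq_condExp_of_indep (hGH hG) hH hX hY hind hφ hC)
    _ = P[fun ω => φ (X ω, Y ω) | G] := condExp_of_stronglyMeasurable (hm.trans hH)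
        (stronglyMeasurable_condExp.mono le_sup_right) integrable_condExp

/-- **Adapted processes are temporally compatible with the noise** (Lemma on compatibility of
SPDE solutions): if `u` is a jointly measurable `(𝓕 t)`-adapted process with paths in `ι (𝔹)`
and `W` is a `U`-cylindrical Brownian motion w.r.t. `(𝓕 t)` with continuous versions `(Wk k)`,
then `u` is compatible with `η = (u (0), (Wk))` for the temporal compatibility structure:
for every bounded Borel `h` and every `t ∈ Ī_T`,
`E[h (η) | 𝓕ₜ^u ∨ 𝓕ₜ^η] = E[h (η) | 𝓕ₜ^η]` `P`-a.s. -/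
theorem compatible_of_adapted
    {Z 𝔹 : Type*}
    [NormedAddCommGroup U] [InnerProductSpace ℝ U] [SecondCountableTopology U] [CompleteSpace U]
    [NormedAddCommGroup Z] [NormedSpace ℝ Z] [SecondCountableTopology Z] [CompleteSpace Z]
    [MeasurableSpace Z] [BorelSpace Z]
    [TopologicalSpace 𝔹] [PolishSpace 𝔹]
    (T : ℝ≥0∞) (hT : 0 < T)
    (ι : 𝔹 → C(↥(timeSet T), Z)) (hι : Continuous ι) (hιinj : Function.Injective ι)
    [mΩ : MeasurableSpace Ω] (P : Measure Ω) [IsProbabilityMeasure P]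
    (𝓕 : ℝ → MeasurableSpace Ω) (h𝓕mono : Monotone 𝓕) (h𝓕le : ∀ t, 𝓕 t ≤ mΩ)
    (W : Lp U 2 timeMeasure →L[ℝ] Lp ℝ 2 P) (hW : IsCylindricalBM P 𝓕 W)
    (e : HilbertBasis ℕ ℝ U) (Wk : ℕ → ℝ → Ω → ℝ)
    (hWk : IsVersions P W (fun k => e k) Wk)
    (u : ↥(timeSet T) → Ω → Z)
    (humeas : Measurable fun p : ↥(timeSet T) × Ω => u p.1 p.2)
    (huadapt : ∀ s : ↥(timeSet T), Measurable[𝓕 ↑s] (u s))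
    (hupath : ∀ ω, ∃ v : 𝔹, ∀ s, (ι v) s = u s ω) :
    ∀ h : Z × (↥(timeSet T) → ℕ → ℝ) → ℝ,
      Measurable h → (∃ C : ℝ, ∀ x, |h x| ≤ C) → ∀ t ∈ timeSet T,
        P[(fun ω => h (u (timeZero T) ω, fun p : ↥(timeSet T) => fun k : ℕ => Wk k ↑p ω)) |
            ((⨆ (s : ↥(timeSet T)) (_ : (s : ℝ) ≤ t),
                MeasurableSpace.comap (u s) inferInstance) ⊔ mnullSigma P) ⊔
            ((MeasurableSpace.comap (u (timeZero T)) inferInstance ⊔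
              ⨆ (k : ℕ) (s : ↥(timeSet T)) (_ : (s : ℝ) ≤ t),
                MeasurableSpace.comap (Wk k ↑s) inferInstance) ⊔ mnullSigma P)]
          =ᵐ[P]
        P[(fun ω => h (u (timeZero T) ω, fun p : ↥(timeSet T) => fun k : ℕ => Wk k ↑p ω)) |
            (MeasurableSpace.comap (u (timeZero T)) inferInstance ⊔
              ⨆ (k : ℕ) (s : ↥(timeSet T)) (_ : (s : ℝ) ≤ t),
                MeasurableSpace.comap (Wk k ↑s) inferInstance) ⊔ mnullSigma P] := by
  rintro h hh ⟨C, hC⟩ t ht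
  have ht0 : 0 ≤ t := ht.1
  have hmin : ∀ s : ↥(timeSet T), min (s : ℝ) t ∈ timeSet T := fun s => by
    rcases min_choice (s : ℝ) t with h | h <;> rw [h]
    exacts [s.2, ht]
  have hfin : ∀ s : ℝ, timeMeasure (Set.Ioc 0 s) ≠ ∞ := fun s =>
    ((Measure.restrict_apply_le _ _).trans_lt measure_Ioc_lt_top).ne
  set f : ℕ → ℝ → Lp U 2 timeMeasure := fun k s =>
    indicatorConstLp 2 (measurableSet_Ioc (a := (0 : ℝ)) (b := s)) (hfin s) (e k)
  have hfind : ∀ k s, (f k s : ℝ → U) =ᵐ[timeMeasure] (Set.Ioc 0 s).indicator fun _ => e k :=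
    fun k s => indicatorConstLp_coeFn
  have hWf : ∀ k s, 0 ≤ s → Wk k s =ᵐ[P] (W (f k s) : Ω → ℝ) := fun k s hs =>
    hWk.2 k s hs (f k s) (hfind k s)
  -- `X` is known at time `t`, and `Y` consists of the increments of the noise after time `t`.
  set X : Ω → Z × (↥(timeSet T) × ℕ → ℝ) := fun ω =>
    (u (timeZero T) ω, fun p => Wk p.2 (min (p.1 : ℝ) t) ω) with hX
  set Y : Ω → ↥(timeSet T) × ℕ → ℝ := fun ω p =>
    Wk p.2 p.1 ω - Wk p.2 (min (p.1 : ℝ) t) ω with hY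
  have hYm : AEMeasurable Y P := by
    obtain ⟨V, hV, hWV⟩ := exists_measurable_indistinguishable (P := P) hWk.1 fun k s hs =>
      (Lp.stronglyMeasurable (W (f k s))).measurable.aemeasurable.congr (hWf k s hs).symm
    refine ⟨fun ω p => V p.2 p.1 ω - V p.2 (min (p.1 : ℝ) t) ω,
      measurable_pi_lambda _ fun p => (hV _ _).sub (hV _ _), ?_⟩
    filter_upwards [hWV] with ω hω
    ext p
    simp only [hY, hω p.2 p.1 p.1.2.1, hω p.2 _ (hmin p.1).1]
  have hind : Indep (𝓕 t) (MeasurableSpace.comap Y inferInstance) P := by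
    have hYf : ∀ p : ↥(timeSet T) × ℕ, (fun ω => Y ω p) =ᵐ[P]
        (W (f p.2 p.1 - f p.2 (min (p.1 : ℝ) t)) : Ω → ℝ) := fun p => by
      rw [map_sub]
      filter_upwards [Lp.coeFn_sub (W (f p.2 p.1)) (W (f p.2 (min (p.1 : ℝ) t))),
        hWf p.2 p.1 p.1.2.1, hWf p.2 _ (hmin p.1).1] with ω h1 h2 h3
      rw [h1, Pi.sub_apply, ← h2, ← h3]
    have hvanish : ∀ p : ↥(timeSet T) × ℕ, ∀ᵐ s ∂timeMeasure, s ∈ Set.Icc (0 : ℝ) t →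
        (f p.2 p.1 - f p.2 (min (p.1 : ℝ) t) : Lp U 2 timeMeasure) s = 0 := fun p => by
      filter_upwards [Lp.coeFn_sub (f p.2 p.1) (f p.2 (min (p.1 : ℝ) t)), hfind p.2 p.1,
        hfind p.2 (min (p.1 : ℝ) t)] with s h1 h2 h3 hs
      rw [h1, Pi.sub_apply, h2, h3, sub_eq_zero]
      simp [Set.indicator_apply, hs.2]
    have hid : Indep ((𝓕 t).comap id) (MeasurableSpace.comap Y inferInstance) P :=
      hW.indepFun_process h𝓕le ht0 hvanish hYf (@measurable_id Ω (𝓕 t))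
    rwa [MeasurableSpace.comap_id] at hid
  have hnull : mnullSigma P ≤ eventuallyMeasurableSpace (𝓕 t) (ae P) ⊓ mΩ :=
    MeasurableSpace.generateFrom_le fun N hN => MeasurableSpace.measurableSet_inf.2
      ⟨⟨∅, @MeasurableSet.empty _ (𝓕 t), ae_eq_empty.2 hN.2⟩, hN.1⟩
  have hu : ∀ s : ↥(timeSet T), (s : ℝ) ≤ t → MeasurableSpace.comap (u s) inferInstance ≤
      eventuallyMeasurableSpace (𝓕 t) (ae P) ⊓ mΩ := fun s hs =>
    ((huadapt s).comap_le.trans (h𝓕mono hs)).trans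
      (le_inf le_eventuallyMeasurableSpace (h𝓕le t))
  have hη : (fun ω => h (u (timeZero T) ω, fun p : ↥(timeSet T) => fun k : ℕ => Wk k ↑p ω)) =
      fun ω => h ((X ω).1, fun p k => (X ω).2 (p, k) + Y ω (p, k)) := by
    simp [hX, hY]
  rw [hη]
  refine condExp_sup_ae_eq_condExp_of_indep (X := X)
    (φ := fun z => h (z.1.1, fun p k => z.1.2 (p, k) + z.2 (p, k)))
    (sup_le (iSup_le fun s => iSup_le fun hs => hu s hs) hnull) (fun hG => ?_) inf_le_right ?_
    hYm (Indep.eventuallyMeasurableSpace_inf hind) (hh.comp (by fun_prop)) fun _ => hC _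
  · refine sup_le (sup_le (hu _ ht0) ?_) hnull
    refine iSup_le fun k => iSup_le fun s => iSup_le fun hs => le_inf ?_ ?_
    · obtain ⟨g, hg, hWg⟩ := hW.2.2.1 t ht0 (f k s) (by
        filter_upwards [hfind k s] with x hx hxt
        rw [hx, Set.indicator_of_notMem fun hxs => hxt ⟨hxs.1.le, hxs.2.trans hs⟩])
      exact (hg.eventuallyMeasurable_of_eventuallyEq
        ((hWf k s s.2.1).trans hWg)).comap_le
    · refine le_trans ?_ hG
      exact le_sup_of_le_left <| le_sup_of_le_right <| le_iSup_of_le k <|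
        le_iSup₂_of_le s hs le_rfl
  · refine @Measurable.prodMk _ _ _ _ _ (_) _ _ (measurable_iff_comap_le.2 (le_sup_left.trans le_sup_left))
      (@measurable_pi_lambda _ _ _ (_) _ _ fun p => measurable_iff_comap_le.2 ?_)
    exact le_sup_of_le_left <| le_sup_of_le_right <| le_iSup_of_le p.2 <|
      le_iSup₂_of_le ⟨_, hmin p.1⟩ (min_le_right _ _) le_rfl

end YWE12
end
end

section
/- Let T ∈ (0,∞], let 𝔹 be a Polish space, Z a separable real Banach space, and ι : 𝔹 → C(Ī_T; Z) a continuous injection. Let X̃ be a separable real Banach space with a continuous injection κ : X̃ → Z, let E be a separable real Banach space, and let b̄ : I_T × X̃ → E be Borel measurable. Define b : I_T × 𝔹 → E by b(t, v) := b̄(t, x) if ι(v)(t) = κ(x) for some (necessarily unique) x ∈ X̃, and b(t, v) := b̄(t, 0) otherwise. Then b is B(I_T) ⊗ B(𝔹)/B(E)-measurable, and for every t ∈ I_T, b(t, ·) is B_t(𝔹)/B(E)-measurable, where B_t(𝔹) := σ(v ↦ ι(v)(s) : s ∈ [0,t] ∩ Ī_T). -/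
open MeasureTheory
open scoped NNReal ENNReal

noncomputable section

namespace YWE15

/-- The time interval `Ī_T = [0, T]` for `T ∈ (0, ∞]` (equal to `[0, ∞)` when `T = ∞`). -/
def timeSet (T : ℝ≥0∞) : Set ℝ := {s : ℝ | 0 ≤ s ∧ ENNReal.ofReal s ≤ T}

/-- The open time interval `I_T = (0, T)`. -/
def ioTime (T : ℝ≥0∞) : Set ℝ := {s : ℝ | 0 < s ∧ ENNReal.ofReal s < T}

/-- The inclusion `I_T ⊆ Ī_T`. -/
def ioToCl {T : ℝ≥0∞} (t : ↥(ioTime T)) : ↥(timeSet T) :=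
  ⟨(t : ℝ), ⟨t.2.1.le, t.2.2.le⟩⟩

/-- The σ-algebra `𝓑ₜ(𝔹)` on `𝔹` generated by the point evaluations of the embedded path up
to time `t`. -/
def pathEvalSigma {𝔹 Z : Type*} [TopologicalSpace 𝔹] [TopologicalSpace Z] [MeasurableSpace Z]
    {T : ℝ≥0∞} (ι : 𝔹 → C(↥(timeSet T), Z)) (t : ℝ) : MeasurableSpace 𝔹 :=
  ⨆ (s : ↥(timeSet T)) (_ : (s : ℝ) ≤ t),
    MeasurableSpace.comap (fun v => (ι v) s) inferInstance

theorem isClosed_timeSet (T : ℝ≥0∞) : IsClosed (timeSet T) :=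
  isClosed_Ici.inter (isClosed_Iic.preimage ENNReal.continuous_ofReal)

theorem continuous_ioToCl {T : ℝ≥0∞} :
    Continuous (ioToCl : ↥(ioTime T) → ↥(timeSet T)) :=
  continuous_subtype_val.subtype_mk _

theorem measurable_eval_pathEvalSigma {𝔹 Z : Type*} [TopologicalSpace 𝔹] [TopologicalSpace Z]
    [MeasurableSpace Z] {T : ℝ≥0∞} (ι : 𝔹 → C(↥(timeSet T), Z)) {t : ℝ} (s : ↥(timeSet T))
    (hs : (s : ℝ) ≤ t) : Measurable[pathEvalSigma ι t] fun v => (ι v) s :=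
  Measurable.of_comap_le (le_iSup₂_of_le s hs le_rfl)

/-- **The Markovian form of the coefficients fits the framework.**
Given Borel measurable `b̄ : I_T × X̃ → E` and the coefficient
`b (t, v) = b̄ (t, x)` if `ι (v) (t) = κ (x)` for some (unique) `x ∈ X̃`, and
`b (t, v) = b̄ (t, 0)` otherwise, the map `b` is jointly Borel measurable and `b (t, ·)` is
`𝓑ₜ(𝔹)`-measurable for every `t ∈ I_T`. -/
theorem markovian_coefficients_measurable
    {𝔹 Z Xt E : Type*}
    [TopologicalSpace 𝔹] [PolishSpace 𝔹] [MeasurableSpace 𝔹] [BorelSpace 𝔹]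
    [NormedAddCommGroup Z] [NormedSpace ℝ Z] [SecondCountableTopology Z] [CompleteSpace Z]
    [MeasurableSpace Z] [BorelSpace Z]
    [NormedAddCommGroup Xt] [NormedSpace ℝ Xt] [SecondCountableTopology Xt] [CompleteSpace Xt]
    [MeasurableSpace Xt] [BorelSpace Xt]
    [NormedAddCommGroup E] [NormedSpace ℝ E] [SecondCountableTopology E] [CompleteSpace E]
    [MeasurableSpace E] [BorelSpace E]
    (T : ℝ≥0∞) (hT : 0 < T)
    (ι : 𝔹 → C(↥(timeSet T), Z)) (hι : Continuous ι) (hιinj : Function.Injective ι)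
    (κ : Xt → Z) (hκ : Continuous κ) (hκinj : Function.Injective κ)
    (bbar : ↥(ioTime T) → Xt → E)
    (hbbar : Measurable fun q : ↥(ioTime T) × Xt => bbar q.1 q.2)
    (b : ↥(ioTime T) → 𝔹 → E)
    (hb1 : ∀ (t : ↥(ioTime T)) (v : 𝔹) (x : Xt),
      (ι v) (ioToCl t) = κ x → b t v = bbar t x)
    (hb2 : ∀ (t : ↥(ioTime T)) (v : 𝔹),
      (∀ x : Xt, (ι v) (ioToCl t) ≠ κ x) → b t v = bbar t 0) :
    (Measurable fun q : ↥(ioTime T) × 𝔹 => b q.1 q.2) ∧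
    (∀ t : ↥(ioTime T),
      @Measurable 𝔹 E (pathEvalSigma ι (t : ℝ)) inferInstance (b t)) := by
  have hκm : MeasurableEmbedding κ := hκ.measurableEmbedding hκinj
  -- the measurable left inverse of `κ` that vanishes off its range
  let r : Z → Xt := Function.extend κ id fun _ => 0
  have hr : Measurable r := hκm.measurable_extend measurable_id measurable_const
  have hb : ∀ t v, b t v = bbar t (r ((ι v) (ioToCl t))) := by
    intro t v
    by_cases h : ∃ x, κ x = (ι v) (ioToCl t)
    · obtain ⟨x, hx⟩ := h
      rw [hb1 t v x hx.symm, ← hx]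
      simp only [r, hκinj.extend_apply, id]
    · rw [hb2 t v fun x hx => h ⟨x, hx.symm⟩]
      simp only [r, Function.extend_apply' _ _ _ h]
  refine ⟨?_, fun t => ?_⟩
  · have : LocallyCompactSpace ↥(timeSet T) := (isClosed_timeSet T).locallyCompactSpace
    have heval : Continuous fun q : ↥(ioTime T) × 𝔹 => (ι q.2) (ioToCl q.1) :=
      (hι.comp continuous_snd).eval (continuous_ioToCl.comp continuous_fst)
    simp only [hb]
    exact hbbar.comp (measurable_fst.prodMk (hr.comp heval.measurable))
  · have hbt : b t = (fun z => bbar t (r z)) ∘ fun v => (ι v) (ioToCl t) := funext (hb t)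
    rw [hbt]
    exact (hbbar.comp (measurable_const.prodMk hr)).comp
      (measurable_eval_pathEvalSigma ι (ioToCl t) le_rfl)

end YWE15
end
end

section
/- Let S be a Polish space and let Y be a completely Hausdorff topological space, i.e. any two distinct points of Y are separated by a continuous real-valued function on Y. Let Γ be a collection of continuous maps from S to Y that separates the points of S. Then the Borel σ-algebra of S equals σ(Γ), the σ-algebra on S generated by the sets γ⁻¹(B) with γ ∈ Γ and B a Borel subset of Y. -/
/-- On a second-countable space, a family of continuous maps into a Hausdorff space that separates
points has a countable subfamily that still separates points. -/
theorem exists_countable_separating_of_continuous {X Z ι : Type*} [TopologicalSpace X]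
    [SecondCountableTopology X] [TopologicalSpace Z] [T2Space Z] (g : ι → X → Z)
    (hg : ∀ i, Continuous (g i)) (hsep : ∀ x y, x ≠ y → ∃ i, g i x ≠ g i y) :
    ∃ T : Set ι, T.Countable ∧ ∀ x y, x ≠ y → ∃ i ∈ T, g i x ≠ g i y := by
  obtain ⟨T, hT, hU⟩ := TopologicalSpace.isOpen_iUnion_countable
    (fun i => {p : X × X | g i p.1 ≠ g i p.2})
    (fun i => isOpen_ne_fun ((hg i).comp continuous_fst) ((hg i).comp continuous_snd))
  refine ⟨T, hT, fun x y hxy => ?_⟩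
  have hmem : (x, y) ∈ ⋃ i ∈ T, {p : X × X | g i p.1 ≠ g i p.2} := by
    rw [hU]
    exact Set.mem_iUnion.2 (hsep x y hxy)
  simpa using hmem

open scoped MeasureTheory in
/-- A σ-algebra on a Polish space that makes a point-separating family of continuous real functions
measurable contains the Borel σ-algebra. -/
theorem borel_le_of_separating_continuous_measurable {X ι : Type*} [TopologicalSpace X]
    [PolishSpace X] (m : MeasurableSpace X) (g : ι → X → ℝ) (hg : ∀ i, Continuous (g i))
    (hm : ∀ i, Measurable[m] (g i)) (hsep : ∀ x y, x ≠ y → ∃ i, g i x ≠ g i y) :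
    borel X ≤ m := by
  obtain ⟨T, hT, hTsep⟩ := exists_countable_separating_of_continuous g hg hsep
  have : Countable T := hT.to_subtype
  let F : X → T → ℝ := fun x i => g i x
  have hF : Continuous F := continuous_pi fun i => hg i
  have hinj : Function.Injective F := by
    intro x y hxy
    by_contra hne
    obtain ⟨i, hi, h⟩ := hTsep x y hne
    exact h (congrFun hxy ⟨i, hi⟩)
  have hcomap : MeasurableSpace.comap F MeasurableSpace.pi = borel X := by
    let _ : MeasurableSpace X := borel X
    have : BorelSpace X := ⟨rfl⟩
    exact (hF.measurableEmbedding hinj).comap_eq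
  rw [← hcomap]
  exact (measurable_pi_iff.2 fun i : T => hm i).comap_le

/-- **Lemma (generating the Borel σ-algebra).**
Let `S` be a Polish space and `Y` a completely Hausdorff space (any two distinct points of `Y`
are separated by a continuous real-valued function).  If `Γ` is a collection of continuous maps
`S → Y` separating the points of `S`, then the Borel σ-algebra of `S` is generated by `Γ`,
i.e. it equals the σ-algebra generated by the sets `γ ⁻¹' B` for `γ ∈ Γ` and `B` Borel in `Y`. -/
theorem borel_eq_iSup_comap_of_separating_continuous
    {S Y : Type*} [TopologicalSpace S] [PolishSpace S] [TopologicalSpace Y]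
    (hY : ∀ y₁ y₂ : Y, y₁ ≠ y₂ → ∃ f : Y → ℝ, Continuous f ∧ f y₁ ≠ f y₂)
    (Γ : Set (S → Y)) (hΓcont : ∀ γ ∈ Γ, Continuous γ)
    (hsep : ∀ s t : S, s ≠ t → ∃ γ ∈ Γ, γ s ≠ γ t) :
    borel S = ⨆ γ ∈ Γ, MeasurableSpace.comap γ (borel Y) := by
  apply le_antisymm
  · refine borel_le_of_separating_continuous_measurable _
      (fun (i : Γ × {f : Y → ℝ // Continuous f}) s => i.2.1 (i.1.1 s))
      (fun i => i.2.2.comp (hΓcont _ i.1.2)) (fun i => ?_) fun s t hst => ?_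
    · let _ : MeasurableSpace Y := borel Y
      have : BorelSpace Y := ⟨rfl⟩
      refine i.2.2.measurable.comp (Measurable.of_comap_le ?_)
      exact le_iSup₂_of_le i.1.1 i.1.2 le_rfl
    · obtain ⟨γ, hγ, hne⟩ := hsep s t hst
      obtain ⟨f, hf, hfne⟩ := hY _ _ hne
      exact ⟨(⟨γ, hγ⟩, ⟨f, hf⟩), hfne⟩
  · exact iSup₂_le fun γ hγ => (hΓcont γ hγ).borel_measurable.comap_le
end

section
/- Let S be a Polish space and let Y be a second-countable Hausdorff topological space. Let Γ₀ be a countable collection of Borel measurable maps from S to Y that separates the points of S. Then the Borel σ-algebra of S equals σ(Γ₀), the σ-algebra on S generated by the sets γ⁻¹(B) with γ ∈ Γ₀ and B a Borel subset of Y. -/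
/-- **Lemma (generating the Borel σ-algebra, countable case).**
Let `S` be a Polish space and `Y` a second-countable Hausdorff space.  If `Γ₀` is a countable
collection of Borel measurable maps `S → Y` separating the points of `S`, then the Borel
σ-algebra of `S` equals the σ-algebra generated by `Γ₀`, i.e. the σ-algebra generated by the
sets `γ ⁻¹' B` for `γ ∈ Γ₀` and `B` Borel in `Y`. -/
theorem borel_eq_iSup_comap_of_separating_countable
    {S Y : Type*} [TopologicalSpace S] [PolishSpace S]
    [TopologicalSpace Y] [SecondCountableTopology Y] [T2Space Y]
    (Γ₀ : Set (S → Y)) (hcount : Γ₀.Countable)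
    (hmeas : ∀ γ ∈ Γ₀, @Measurable S Y (borel S) (borel Y) γ)
    (hsep : ∀ s t : S, s ≠ t → ∃ γ ∈ Γ₀, γ s ≠ γ t) :
    borel S = ⨆ γ ∈ Γ₀, MeasurableSpace.comap γ (borel Y) := by
  set m : MeasurableSpace S := ⨆ γ ∈ Γ₀, MeasurableSpace.comap γ (borel Y)
  have hle : m ≤ borel S :=
    iSup₂_le fun γ hγ => measurable_iff_comap_le.mp (hmeas γ hγ)
  have hsepm : @MeasurableSpace.CountablySeparated S m := by
    refine (MeasurableSpace.countablySeparated_def).mpr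
      ⟨Set.image2 (fun γ b => γ ⁻¹' b) Γ₀ (TopologicalSpace.countableBasis Y),
        hcount.image2 (TopologicalSpace.countable_countableBasis Y) _, ?_, ?_⟩
    · rintro _ ⟨γ, hγ, b, hb, rfl⟩
      have hγm : MeasurableSpace.comap γ (borel Y) ≤ m :=
        le_iSup₂ (f := fun γ (_ : γ ∈ Γ₀) => MeasurableSpace.comap γ (borel Y)) γ hγ
      exact hγm _ ⟨b, MeasurableSpace.measurableSet_generateFrom
        (TopologicalSpace.isOpen_of_mem_countableBasis hb), rfl⟩
    · intro s _ t _ h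
      by_contra hne
      obtain ⟨γ, hγ, hst⟩ := hsep s t hne
      refine hst ((TopologicalSpace.isBasis_countableBasis Y).inseparable_iff.mpr ?_).eq
      exact fun b hb => h _ ⟨γ, hγ, b, hb, rfl⟩
  have hstd : @StandardBorelSpace S (borel S) :=
    @StandardBorelSpace.mk S (borel S) ⟨_, @BorelSpace.mk S _ (borel S) rfl, inferInstance⟩
  have hid : @Measurable S S (borel S) m id := fun _ hs => hle _ hs
  simpa only [MeasurableSpace.map_id] using
    @Measurable.map_measurableSpace_eq S S (borel S) hstd m hsepm id hid Function.surjective_id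
end
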